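/- Degree n+1 dynamical Yang–Baxter relation: let n ≥ 1, write Y_θ(ν₁,…,ν_n) = ℬ(ν₁, θ+γ) ℬ(ν₂, θ+2γ) ⋯ ℬ(ν_n, θ+nγ). Then for all λ₀, λ₁,…,λ_n, θ ∈ ℂ such that all theta-function denominators occurring are nonzero, as operators on (ℂ²)^{⊗L}: 𝒜(λ₀, θ+γ) Y_{θ−γ}(λ₁,…,λ_n) = [f(θ+γ)/f(θ+(n+1)γ)] ∏_{j=1}^{n} [f(λ_j−λ₀+γ)/f(λ_j−λ₀)] Y_θ(λ₁,…,λ_n) 𝒜(λ₀, θ+(n+1)γ) − ∑_{i=1}^{n} [f(θ+γ−λ_i+λ₀)/f(θ+(n+1)γ)] [f(γ)/f(λ_i−λ₀)] ∏_{j≠i} [f(λ_j−λ_i+γ)/f(λ_j−λ_i)] Y_θ(λ₀, λ₁,…,λ_{i−1}, λ_{i+1},…,λ_n) 𝒜(λ_i, θ+(n+1)γ). -/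

import Mathlib

noncomputable section

/-- `f(λ) = Θ₁(iλ, τ)/2`, where
`Θ₁(z, τ) = 2 ∑_{n=0}^{∞} (−1)ⁿ e^{iπτ(n+1/2)²} sin((2n+1)z)` is the Jacobi
theta function `θ₁`. -/
def thetaf (τ lam : ℂ) : ℂ :=
  ∑' n : ℕ,
    (-1) ^ n * Complex.exp ((Real.pi : ℂ) * Complex.I * τ * ((n : ℂ) + 1 / 2) ^ 2) *
      Complex.sin ((2 * (n : ℂ) + 1) * (Complex.I * lam))

/-- The elliptic dynamical R-matrix `R(λ, θ)` on `ℂ² ⊗ ℂ²`, in the ordered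
basis `(e₁⊗e₁, e₁⊗e₂, e₂⊗e₁, e₂⊗e₂)` encoded by pairs in `Fin 2 × Fin 2`. -/
def Rdyn (τ γ lam θ : ℂ) : Matrix (Fin 2 × Fin 2) (Fin 2 × Fin 2) ℂ :=
  fun p q =>
    if p = q then
      (if p.1 = p.2 then thetaf τ (lam + γ)
       else if p.1 = 0 then thetaf τ lam * thetaf τ (θ - γ) / thetaf τ θ
       else thetaf τ lam * thetaf τ (θ + γ) / thetaf τ θ)
    else if p.1 = q.2 ∧ p.2 = q.1 then
      (if p.1 = 0 then thetaf τ γ * thetaf τ (θ - lam) / thetaf τ θ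
       else thetaf τ γ * thetaf τ (θ + lam) / thetaf τ θ)
    else 0

/-- The `h`-eigenvalue of the basis vector `e_s` of `ℂ²`: `ε₁ = 1, ε₂ = −1`. -/
def eps (s : Fin 2) : ℂ := if s = 0 then 1 else -1

/-- `R_{ai}(λ, θ − γ ∑_{k>i} h_k)` on `ℂ² ⊗ (ℂ²)^{⊗L}`: it acts as
`R(λ, θ − γ s)` on the auxiliary factor and the `i`-th quantum factor, on each
joint `h`-eigenvector of the quantum factors `k > i` with eigenvalue sum `s`,
and as the identity on the remaining factors. -/
def RaiDyn (τ γ : ℂ) {L : ℕ} (lam θ : ℂ) (i : Fin L) :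
    Matrix (Fin 2 × (Fin L → Fin 2)) (Fin 2 × (Fin L → Fin 2)) ℂ :=
  fun p q =>
    Rdyn τ γ lam (θ - γ * ∑ k ∈ Finset.univ.filter (fun k => i < k), eps (q.2 k))
      (p.1, p.2 i) (q.1, q.2 i) *
      (if ∀ k, k ≠ i → p.2 k = q.2 k then 1 else 0)

/-- The dynamical monodromy matrix
`𝒯(λ, θ) = R_{a1}(λ−μ₁, θ−γ∑_{k>1}h_k) ⋯ R_{aL}(λ−μ_L, θ)`. -/
def Tdyn (τ γ : ℂ) {L : ℕ} (μ : Fin L → ℂ) (lam θ : ℂ) :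
    Matrix (Fin 2 × (Fin L → Fin 2)) (Fin 2 × (Fin L → Fin 2)) ℂ :=
  (List.ofFn fun i : Fin L => RaiDyn τ γ (lam - μ i) θ i).prod

/-- `𝒜(λ, θ)`: the (1,1) block of `𝒯(λ, θ)` with respect to the auxiliary
factor. -/
def Adyn (τ γ : ℂ) {L : ℕ} (μ : Fin L → ℂ) (lam θ : ℂ) :
    Matrix (Fin L → Fin 2) (Fin L → Fin 2) ℂ :=
  fun p q => Tdyn τ γ μ lam θ (0, p) (0, q)

/-- `ℬ(λ, θ)`: the (1,2) block of `𝒯(λ, θ)` with respect to the auxiliary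
factor. -/
def Bdyn (τ γ : ℂ) {L : ℕ} (μ : Fin L → ℂ) (lam θ : ℂ) :
    Matrix (Fin L → Fin 2) (Fin L → Fin 2) ℂ :=
  fun p q => Tdyn τ γ μ lam θ (0, p) (1, q)

/-- `Y_θ(ν₁,…,ν_n) = ℬ(ν₁, θ+γ) ℬ(ν₂, θ+2γ) ⋯ ℬ(ν_n, θ+nγ)`. -/
def Ydyn (τ γ : ℂ) {L : ℕ} (μ : Fin L → ℂ) (θ : ℂ) {n : ℕ} (ν : Fin n → ℂ) :
    Matrix (Fin L → Fin 2) (Fin L → Fin 2) ℂ :=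
  (List.ofFn fun i : Fin n => Bdyn τ γ μ (ν i) (θ + (((i : ℕ) : ℂ) + 1) * γ)).prod



/-- The bilateral summand of `thetaf`. -/
def gterm (τ lam : ℂ) (n : ℤ) : ℂ :=
  (1 / (2 * Complex.I)) * Complex.exp ((Real.pi : ℂ) * Complex.I * τ * ((n : ℂ) + 1 / 2) ^ 2 +
    (Real.pi : ℂ) * Complex.I * n - (2 * (n : ℂ) + 1) * lam)

lemma gterm_eq (τ lam : ℂ) (n : ℤ) :
    gterm τ lam n = (1 / (2 * Complex.I) * Complex.exp ((Real.pi : ℂ) * Complex.I * τ / 4 - lam)) *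
      jacobiTheta₂_term n (1 / 2 + τ / 2 + Complex.I * lam / Real.pi) τ := by
  have hpi : (Real.pi : ℂ) ≠ 0 := by exact_mod_cast Real.pi_ne_zero
  rw [gterm, jacobiTheta₂_term, mul_assoc (1 / (2 * Complex.I)), ← Complex.exp_add]
  congr 2
  field_simp
  ring_nf
  simp only [Complex.I_sq]
  ring

lemma gterm_hasSum (τ lam : ℂ) (hτ : 0 < τ.im) :
    HasSum (gterm τ lam)
      ((1 / (2 * Complex.I) * Complex.exp ((Real.pi : ℂ) * Complex.I * τ / 4 - lam)) *
      jacobiTheta₂ (1 / 2 + τ / 2 + Complex.I * lam / Real.pi) τ) := by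
  have h := (hasSum_jacobiTheta₂_term (1 / 2 + τ / 2 + Complex.I * lam / Real.pi) hτ).mul_left
    (1 / (2 * Complex.I) * Complex.exp ((Real.pi : ℂ) * Complex.I * τ / 4 - lam))
  exact h.congr_fun (fun n => gterm_eq τ lam n)

lemma exp_pi_I_int (n : ℤ) : Complex.exp ((Real.pi : ℂ) * Complex.I * n) = (-1) ^ n := by
  rw [mul_comm, Complex.exp_int_mul, Complex.exp_pi_mul_I]

lemma gterm_fold (τ lam : ℂ) (n : ℕ) :
    (-1) ^ n * Complex.exp ((Real.pi : ℂ) * Complex.I * τ * ((n : ℂ) + 1 / 2) ^ 2) *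
      Complex.sin ((2 * (n : ℂ) + 1) * (Complex.I * lam)) =
    gterm τ lam n + gterm τ lam (-((n : ℤ) + 1)) := by
  have hI : Complex.I ≠ 0 := Complex.I_ne_zero
  have e1 : Complex.exp ((Real.pi : ℂ) * Complex.I * ((n : ℤ) : ℂ)) = (-1) ^ n := by
    rw [exp_pi_I_int]; simp
  have e2 : Complex.exp ((Real.pi : ℂ) * Complex.I * ((-((n : ℤ) + 1) : ℤ) : ℂ)) = -(-1) ^ n := by
    rw [exp_pi_I_int, zpow_neg, ← inv_zpow]
    norm_num
    rw [zpow_add₀ (by norm_num)]; simp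
  rw [gterm, gterm, Complex.exp_sub, Complex.exp_add, Complex.exp_sub, Complex.exp_add, e1, e2,
    Complex.sin]
  have a1 : Complex.exp (-((2 * (n : ℂ) + 1) * (Complex.I * lam)) * Complex.I)
      = Complex.exp ((2 * (n : ℂ) + 1) * lam) := by
    congr 1
    linear_combination -(2 * (n : ℂ) + 1) * lam * Complex.I_mul_I
  have a2 : Complex.exp (((2 * (n : ℂ) + 1) * (Complex.I * lam)) * Complex.I)
      = (Complex.exp ((2 * (n : ℂ) + 1) * lam))⁻¹ := by
    rw [← Complex.exp_neg]
    congr 1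
    linear_combination (2 * (n : ℂ) + 1) * lam * Complex.I_mul_I
  have a3 : Complex.exp ((2 * ((-((n : ℤ) + 1) : ℤ) : ℂ) + 1) * lam)
      = (Complex.exp ((2 * (n : ℂ) + 1) * lam))⁻¹ := by
    rw [← Complex.exp_neg]
    congr 1
    push_cast
    ring
  have a4 : (((-((n : ℤ) + 1) : ℤ) : ℂ) + 1 / 2) ^ 2 = ((n : ℂ) + 1 / 2) ^ 2 := by
    push_cast; ring
  rw [a1, a2, a3, a4]
  have := Complex.exp_ne_zero ((2 * (n : ℂ) + 1) * lam)
  push_cast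
  field_simp
  simp only [Complex.I_sq]
  ring

lemma thetaf_tsum (τ lam : ℂ) (hτ : 0 < τ.im) : thetaf τ lam = ∑' n : ℤ, gterm τ lam n := by
  have h := (gterm_hasSum τ lam hτ).nat_add_neg_add_one
  rw [(gterm_hasSum τ lam hτ).tsum_eq, thetaf, ← h.tsum_eq]
  exact tsum_congr (fun n => gterm_fold τ lam n)

lemma thetaf_eq (τ lam : ℂ) (hτ : 0 < τ.im) : thetaf τ lam =
      ((1 / (2 * Complex.I) * Complex.exp ((Real.pi : ℂ) * Complex.I * τ / 4 - lam)) *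
      jacobiTheta₂ (1 / 2 + τ / 2 + Complex.I * lam / Real.pi) τ) := by
  rw [thetaf_tsum τ lam hτ, (gterm_hasSum τ lam hτ).tsum_eq]

lemma thetaf_differentiable (τ : ℂ) (hτ : 0 < τ.im) : Differentiable ℂ (thetaf τ) := by
  have : thetaf τ = fun lam => ((1 / (2 * Complex.I) *
      Complex.exp ((Real.pi : ℂ) * Complex.I * τ / 4 - lam)) *
      jacobiTheta₂ (1 / 2 + τ / 2 + Complex.I * lam / Real.pi) τ) := by
    funext lam; exact thetaf_eq τ lam hτ
  rw [this]
  intro x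
  have h2 : DifferentiableAt ℂ
      (fun lam : ℂ => jacobiTheta₂ (1 / 2 + τ / 2 + Complex.I * lam / Real.pi) τ) x := by
    exact DifferentiableAt.comp (g := fun z => jacobiTheta₂ z τ) x
      (differentiableAt_jacobiTheta₂_fst _ hτ) (by fun_prop)
  exact DifferentiableAt.mul (by fun_prop) h2

lemma thetaf_neg (τ x : ℂ) : thetaf τ (-x) = - thetaf τ x := by
  unfold thetaf
  rw [← tsum_neg]
  congr 1
  funext n
  rw [show (2 * (n : ℂ) + 1) * (Complex.I * -x) = -((2 * (n : ℂ) + 1) * (Complex.I * x)) by ring,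
    Complex.sin_neg]
  ring

lemma thetaf_zero (τ : ℂ) : thetaf τ 0 = 0 := by
  simp [thetaf]

/-- Odd half-lattice summand. -/
def uterm (τ x : ℂ) (l : ℤ) : ℂ :=
  Complex.exp ((Real.pi : ℂ) * Complex.I * τ * (2 * (l : ℂ) + 1) ^ 2 / 2 - 2 * (2 * (l : ℂ) + 1) * x)

/-- Even half-lattice summand. -/
def vterm (τ x : ℂ) (l : ℤ) : ℂ :=
  Complex.exp ((Real.pi : ℂ) * Complex.I * τ * (2 * (l : ℂ)) ^ 2 / 2 - 2 * (2 * (l : ℂ)) * x)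

lemma im_two_mul_pos (τ : ℂ) (hτ : 0 < τ.im) : 0 < (2 * τ).im := by
  simp; exact hτ

lemma vterm_summable (τ x : ℂ) (hτ : 0 < τ.im) : Summable (vterm τ x) := by
  have h := (hasSum_jacobiTheta₂_term (2 * Complex.I * x / Real.pi) (im_two_mul_pos τ hτ)).summable
  convert h using 1
  funext l
  have hpi : (Real.pi : ℂ) ≠ 0 := by exact_mod_cast Real.pi_ne_zero
  rw [vterm, jacobiTheta₂_term]
  congr 1
  field_simp
  ring_nf
  simp only [Complex.I_sq]
  ring

lemma uterm_summable (τ x : ℂ) (hτ : 0 < τ.im) : Summable (uterm τ x) := by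
  have h := ((hasSum_jacobiTheta₂_term (τ + 2 * Complex.I * x / Real.pi)
    (im_two_mul_pos τ hτ)).summable).mul_left
      (Complex.exp ((Real.pi : ℂ) * Complex.I * τ / 2 - 2 * x))
  refine h.congr (fun l => ?_)
  have hpi : (Real.pi : ℂ) ≠ 0 := by exact_mod_cast Real.pi_ne_zero
  rw [uterm, jacobiTheta₂_term, ← Complex.exp_add]
  congr 1
  field_simp
  ring_nf
  simp only [Complex.I_sq]
  ring

/-- The change of summation variables `(m,n) ↔ (m+n+1, m-n)`. -/
def latEquiv : (ℤ × ℤ) ⊕ (ℤ × ℤ) ≃ ℤ × ℤ where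
  toFun := Sum.elim (fun p => (p.1 + p.2, p.1 - p.2)) (fun p => (p.1 + p.2, p.1 - p.2 - 1))
  invFun p := if (p.1 - p.2) % 2 = 0 then Sum.inl ((p.1 + p.2) / 2, (p.1 - p.2) / 2)
    else Sum.inr ((p.1 + p.2 + 1) / 2, (p.1 - p.2 - 1) / 2)
  left_inv := by
    rintro (⟨l, k⟩ | ⟨l, k⟩)
    · have : (l + k - (l - k)) % 2 = 0 := by omega
      simp only [Sum.elim_inl, this, if_true]
      congr 2 <;> omega
    · have : ¬ (l + k - (l - k - 1)) % 2 = 0 := by omega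
      simp only [Sum.elim_inr, this, if_false]
      congr 2 <;> omega
  right_inv := by
    rintro ⟨m, n⟩
    by_cases h : (m - n) % 2 = 0
    · simp only [h, if_true, Sum.elim_inl, Prod.mk.injEq]
      constructor <;> omega
    · simp only [h, if_false, Sum.elim_inr, Prod.mk.injEq]
      constructor <;> omega

lemma gg_inl (τ x y : ℂ) (l k : ℤ) :
    gterm τ (x + y) (l + k) * gterm τ (x - y) (l - k) = -1 / 4 * (uterm τ x l * vterm τ y k) := by
  rw [gterm, gterm, uterm, vterm, ← Complex.exp_add]
  have hI : (1 / (2 * Complex.I)) * (1 / (2 * Complex.I)) = -1 / 4 := by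
    have := Complex.I_ne_zero
    field_simp
    rw [Complex.I_sq]; norm_num
  rw [mul_mul_mul_comm, hI, ← Complex.exp_add]
  congr 1
  refine Complex.exp_eq_exp_iff_exists_int.mpr ⟨l, ?_⟩
  push_cast
  ring

lemma gg_inr (τ x y : ℂ) (l k : ℤ) :
    gterm τ (x + y) (l + k) * gterm τ (x - y) (l - k - 1) =
      1 / 4 * (vterm τ x l * uterm τ y k) := by
  rw [gterm, gterm, uterm, vterm, ← Complex.exp_add]
  have hI : (1 / (2 * Complex.I)) * (1 / (2 * Complex.I)) = -1 / 4 := by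
    have := Complex.I_ne_zero
    field_simp
    rw [Complex.I_sq]; norm_num
  rw [mul_mul_mul_comm, hI, ← Complex.exp_add]
  have h2 : ∀ z : ℂ, (1 / 4 : ℂ) * Complex.exp z = -1 / 4 * Complex.exp (z + Real.pi * Complex.I) := by
    intro z; rw [Complex.exp_add, Complex.exp_pi_mul_I]; ring
  rw [h2]
  congr 1
  refine Complex.exp_eq_exp_iff_exists_int.mpr ⟨l - 1, ?_⟩
  push_cast
  ring

lemma thetaf_prod (τ x y : ℂ) (hτ : 0 < τ.im) :
    thetaf τ (x + y) * thetaf τ (x - y) =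
      -1 / 4 * ((∑' l, uterm τ x l) * (∑' l, vterm τ y l)) +
       1 / 4 * ((∑' l, vterm τ x l) * (∑' l, uterm τ y l)) := by
  have s1 := (gterm_hasSum τ (x + y) hτ).summable
  have s2 := (gterm_hasSum τ (x - y) hτ).summable
  rw [thetaf_tsum τ _ hτ, thetaf_tsum τ _ hτ,
    tsum_mul_tsum_of_summable_norm s1.norm s2.norm]
  have su := uterm_summable τ x hτ
  have sv := vterm_summable τ x hτ
  have su' := uterm_summable τ y hτ
  have sv' := vterm_summable τ y hτ
  rw [← latEquiv.tsum_eq, Summable.tsum_sum]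
  · rw [tsum_mul_tsum_of_summable_norm su.norm sv'.norm,
      tsum_mul_tsum_of_summable_norm sv.norm su'.norm, ← tsum_mul_left, ← tsum_mul_left]
    congr 1
    · exact tsum_congr (fun p => gg_inl τ x y p.1 p.2)
    · exact tsum_congr (fun p => gg_inr τ x y p.1 p.2)
  · exact ((summable_mul_of_summable_norm su.norm sv'.norm).mul_left (-1 / 4)).congr
      (fun p => (gg_inl τ x y p.1 p.2).symm)
  · exact ((summable_mul_of_summable_norm sv.norm su'.norm).mul_left (1 / 4)).congr
      (fun p => (gg_inr τ x y p.1 p.2).symm)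

/-- The three-term (Weierstrass) identity. -/
lemma thetaf_three (τ x y z w : ℂ) (hτ : 0 < τ.im) :
    thetaf τ (x + y) * thetaf τ (x - y) * (thetaf τ (z + w) * thetaf τ (z - w)) -
    thetaf τ (x + z) * thetaf τ (x - z) * (thetaf τ (y + w) * thetaf τ (y - w)) +
    thetaf τ (x + w) * thetaf τ (x - w) * (thetaf τ (y + z) * thetaf τ (y - z)) = 0 := by
  simp only [thetaf_prod τ _ _ hτ]
  ring


set_option linter.unusedSimpArgs false
set_option linter.unusedVariables false

lemma three_gen (τ : ℂ) (hτ : 0 < τ.im) (X Y Z W a1 a2 a3 a4 a5 a6 a7 a8 a9 a10 a11 a12 : ℂ)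
    (h : (X + Y = a1 ∧ X - Y = a2 ∧ Z + W = a3 ∧ Z - W = a4) ∧
      (X + Z = a5 ∧ X - Z = a6 ∧ Y + W = a7 ∧ Y - W = a8) ∧
      (X + W = a9 ∧ X - W = a10 ∧ Y + Z = a11 ∧ Y - Z = a12)) :
    thetaf τ a1 * thetaf τ a2 * (thetaf τ a3 * thetaf τ a4) -
    thetaf τ a5 * thetaf τ a6 * (thetaf τ a7 * thetaf τ a8) +
    thetaf τ a9 * thetaf τ a10 * (thetaf τ a11 * thetaf τ a12) = 0 := by
  obtain ⟨⟨rfl, rfl, rfl, rfl⟩, ⟨rfl, rfl, rfl, rfl⟩, rfl, rfl, rfl, rfl⟩ := h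
  exact thetaf_three τ X Y Z W hτ

lemma Rdyn_0000 (τ γ lam θ : ℂ) : Rdyn τ γ lam θ (0, 0) (0, 0) =
    thetaf τ (lam + γ) := by
  simp [Rdyn]

lemma Rdyn_0001 (τ γ lam θ : ℂ) : Rdyn τ γ lam θ (0, 0) (0, 1) =
    0 := by
  simp [Rdyn]

lemma Rdyn_0010 (τ γ lam θ : ℂ) : Rdyn τ γ lam θ (0, 0) (1, 0) =
    0 := by
  simp [Rdyn]

lemma Rdyn_0011 (τ γ lam θ : ℂ) : Rdyn τ γ lam θ (0, 0) (1, 1) =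
    0 := by
  simp [Rdyn]

lemma Rdyn_0100 (τ γ lam θ : ℂ) : Rdyn τ γ lam θ (0, 1) (0, 0) =
    0 := by
  simp [Rdyn]

lemma Rdyn_0101 (τ γ lam θ : ℂ) : Rdyn τ γ lam θ (0, 1) (0, 1) =
    thetaf τ lam * thetaf τ (θ - γ) / thetaf τ θ := by
  simp [Rdyn]

lemma Rdyn_0110 (τ γ lam θ : ℂ) : Rdyn τ γ lam θ (0, 1) (1, 0) =
    thetaf τ γ * thetaf τ (θ - lam) / thetaf τ θ := by
  simp [Rdyn]

lemma Rdyn_0111 (τ γ lam θ : ℂ) : Rdyn τ γ lam θ (0, 1) (1, 1) =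
    0 := by
  simp [Rdyn]

lemma Rdyn_1000 (τ γ lam θ : ℂ) : Rdyn τ γ lam θ (1, 0) (0, 0) =
    0 := by
  simp [Rdyn]

lemma Rdyn_1001 (τ γ lam θ : ℂ) : Rdyn τ γ lam θ (1, 0) (0, 1) =
    thetaf τ γ * thetaf τ (θ + lam) / thetaf τ θ := by
  simp [Rdyn]

lemma Rdyn_1010 (τ γ lam θ : ℂ) : Rdyn τ γ lam θ (1, 0) (1, 0) =
    thetaf τ lam * thetaf τ (θ + γ) / thetaf τ θ := by
  simp [Rdyn]

lemma Rdyn_1011 (τ γ lam θ : ℂ) : Rdyn τ γ lam θ (1, 0) (1, 1) =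
    0 := by
  simp [Rdyn]

lemma Rdyn_1100 (τ γ lam θ : ℂ) : Rdyn τ γ lam θ (1, 1) (0, 0) =
    0 := by
  simp [Rdyn]

lemma Rdyn_1101 (τ γ lam θ : ℂ) : Rdyn τ γ lam θ (1, 1) (0, 1) =
    0 := by
  simp [Rdyn]

lemma Rdyn_1110 (τ γ lam θ : ℂ) : Rdyn τ γ lam θ (1, 1) (1, 0) =
    0 := by
  simp [Rdyn]

lemma Rdyn_1111 (τ γ lam θ : ℂ) : Rdyn τ γ lam θ (1, 1) (1, 1) =
    thetaf τ (lam + γ) := by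
  simp [Rdyn]

lemma eps_zero : eps 0 = 1 := by simp [eps]

lemma eps_one : eps 1 = -1 := by simp [eps]

/-- Left side of a component of the dynamical Yang-Baxter equation. -/
def ybL (τ γ x y Θ : ℂ) (a b p e g q : Fin 2) : ℂ :=
  ∑ c, ∑ d, ∑ r, Rdyn τ γ x (Θ - γ * eps p) (a, b) (c, d) * Rdyn τ γ (x + y) Θ (c, p) (e, r) *
    Rdyn τ γ y (Θ - γ * eps e) (d, r) (g, q)

/-- Right side of a component of the dynamical Yang-Baxter equation. -/
def ybR (τ γ x y Θ : ℂ) (a b p e g q : Fin 2) : ℂ :=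
  ∑ c, ∑ d, ∑ s, Rdyn τ γ y Θ (b, p) (d, s) * Rdyn τ γ (x + y) (Θ - γ * eps d) (a, s) (c, q) *
    Rdyn τ γ x Θ (c, d) (e, g)

lemma yb_001_010 (τ γ x y Θ : ℂ) (hτ : 0 < τ.im) (h0 : thetaf τ Θ ≠ 0)
    (hp : thetaf τ (Θ + γ) ≠ 0) (hm : thetaf τ (Θ - γ) ≠ 0) :
    ybL τ γ x y Θ 0 0 1 0 1 0 = ybR τ γ x y Θ 0 0 1 0 1 0 := by
  simp only [ybL, ybR, Fin.sum_univ_two, eps_zero, eps_one, Rdyn_0000, Rdyn_0001, Rdyn_0010, Rdyn_0011, Rdyn_0100, Rdyn_0101, Rdyn_0110, Rdyn_0111, Rdyn_1000, Rdyn_1001, Rdyn_1010, Rdyn_1011, Rdyn_1100, Rdyn_1101, Rdyn_1110, Rdyn_1111,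
    mul_zero, zero_mul, add_zero, zero_add, mul_one, mul_neg, sub_neg_eq_add, sub_add_cancel, add_sub_cancel_right]
  have h1 := three_gen τ hτ (((-1) * y + (-1) * γ + (2) * Θ) / 2) (((-1) * y + (-1) * γ) / 2) (((2) * x + (1) * y + (1) * γ) / 2) (((-1) * y + (1) * γ) / 2)
    (Θ - γ - y) (Θ) (x + γ) (x + y) (Θ + x) (Θ - γ - (x + y)) (-(y)) (-(γ)) (Θ - y) (Θ - γ) (x) (-(x + y + γ))
    (by refine ⟨⟨?_, ?_, ?_, ?_⟩, ⟨?_, ?_, ?_, ?_⟩, ?_, ?_, ?_, ?_⟩ <;> ring)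
  simp only [thetaf_neg] at h1
  linear_combination (norm := (field_simp; ring)) (1) * (thetaf τ (Θ - γ) * thetaf τ (γ)) / (thetaf τ (Θ) * thetaf τ (Θ) * thetaf τ (Θ - γ)) * h1

lemma yb_001_100 (τ γ x y Θ : ℂ) (hτ : 0 < τ.im) (h0 : thetaf τ Θ ≠ 0)
    (hp : thetaf τ (Θ + γ) ≠ 0) (hm : thetaf τ (Θ - γ) ≠ 0) :
    ybL τ γ x y Θ 0 0 1 1 0 0 = ybR τ γ x y Θ 0 0 1 1 0 0 := by
  simp only [ybL, ybR, Fin.sum_univ_two, eps_zero, eps_one, Rdyn_0000, Rdyn_0001, Rdyn_0010, Rdyn_0011, Rdyn_0100, Rdyn_0101, Rdyn_0110, Rdyn_0111, Rdyn_1000, Rdyn_1001, Rdyn_1010, Rdyn_1011, Rdyn_1100, Rdyn_1101, Rdyn_1110, Rdyn_1111,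
    mul_zero, zero_mul, add_zero, zero_add, mul_one, mul_neg, sub_neg_eq_add, sub_add_cancel, add_sub_cancel_right]
  have h1 := three_gen τ hτ (((-1) * x + (-1) * y + (2) * Θ) / 2) (((-1) * x + (-1) * y) / 2) (((1) * x + (1) * y + (2) * γ) / 2) (((-1) * x + (1) * y) / 2)
    (Θ - (x + y)) (Θ) (y + γ) (x + γ) (Θ + γ) (Θ - γ - (x + y)) (-(x)) (-(y)) (Θ - x) (Θ - y) (γ) (-(x + y + γ))
    (by refine ⟨⟨?_, ?_, ?_, ?_⟩, ⟨?_, ?_, ?_, ?_⟩, ?_, ?_, ?_, ?_⟩ <;> ring)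
  simp only [thetaf_neg] at h1
  linear_combination (norm := (field_simp; ring)) (1) * (thetaf τ (Θ - γ) * thetaf τ (γ)) / (thetaf τ (Θ) * thetaf τ (Θ) * thetaf τ (Θ - γ)) * h1

lemma yb_010_001 (τ γ x y Θ : ℂ) (hτ : 0 < τ.im) (h0 : thetaf τ Θ ≠ 0)
    (hp : thetaf τ (Θ + γ) ≠ 0) (hm : thetaf τ (Θ - γ) ≠ 0) :
    ybL τ γ x y Θ 0 1 0 0 0 1 = ybR τ γ x y Θ 0 1 0 0 0 1 := by
  simp only [ybL, ybR, Fin.sum_univ_two, eps_zero, eps_one, Rdyn_0000, Rdyn_0001, Rdyn_0010, Rdyn_0011, Rdyn_0100, Rdyn_0101, Rdyn_0110, Rdyn_0111, Rdyn_1000, Rdyn_1001, Rdyn_1010, Rdyn_1011, Rdyn_1100, Rdyn_1101, Rdyn_1110, Rdyn_1111,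
    mul_zero, zero_mul, add_zero, zero_add, mul_one, mul_neg, sub_neg_eq_add, sub_add_cancel, add_sub_cancel_right]
  have h1 := three_gen τ hτ (((1) * y + (-1) * γ + (2) * Θ) / 2) (((-1) * y + (1) * γ) / 2) (((2) * x + (1) * y + (1) * γ) / 2) (((-1) * y + (-1) * γ) / 2)
    (Θ) (Θ - γ + y) (x) (x + y + γ) (Θ + (x + y)) (Θ - γ - x) (-(y)) (γ) (Θ - γ) (Θ + y) (x + γ) (-(x + y))
    (by refine ⟨⟨?_, ?_, ?_, ?_⟩, ⟨?_, ?_, ?_, ?_⟩, ?_, ?_, ?_, ?_⟩ <;> ring)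
  simp only [thetaf_neg] at h1
  linear_combination (norm := (field_simp; ring)) (1) * (thetaf τ (Θ - γ - γ) * thetaf τ (γ)) / (thetaf τ (Θ - γ) * thetaf τ (Θ - γ) * thetaf τ (Θ)) * h1

lemma yb_010_010 (τ γ x y Θ : ℂ) (hτ : 0 < τ.im) (h0 : thetaf τ Θ ≠ 0)
    (hp : thetaf τ (Θ + γ) ≠ 0) (hm : thetaf τ (Θ - γ) ≠ 0) :
    ybL τ γ x y Θ 0 1 0 0 1 0 = ybR τ γ x y Θ 0 1 0 0 1 0 := by
  simp only [ybL, ybR, Fin.sum_univ_two, eps_zero, eps_one, Rdyn_0000, Rdyn_0001, Rdyn_0010, Rdyn_0011, Rdyn_0100, Rdyn_0101, Rdyn_0110, Rdyn_0111, Rdyn_1000, Rdyn_1001, Rdyn_1010, Rdyn_1011, Rdyn_1100, Rdyn_1101, Rdyn_1110, Rdyn_1111,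
    mul_zero, zero_mul, add_zero, zero_add, mul_one, mul_neg, sub_neg_eq_add, sub_add_cancel, add_sub_cancel_right]
  have h1 := three_gen τ hτ (((-2) * γ + (2) * Θ) / 2) (((-2) * γ) / 2) (((2) * Θ) / 2) 0
    (Θ - γ - γ) (Θ) (Θ) (Θ) ((-1) * γ + (2) * Θ) (-(γ)) (-(γ)) (-(γ)) (Θ - γ) (Θ - γ) (Θ - γ) (-(Θ + γ))
    (by refine ⟨⟨?_, ?_, ?_, ?_⟩, ⟨?_, ?_, ?_, ?_⟩, ?_, ?_, ?_, ?_⟩ <;> ring)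
  simp only [thetaf_neg] at h1
  have h2 := three_gen τ hτ (((-1) * x + (-1) * y + (-2) * γ + (2) * Θ) / 2) (((-1) * x + (1) * y) / 2) (((1) * x + (1) * y + (2) * Θ) / 2) (((-1) * x + (-1) * y) / 2)
    (Θ - γ - x) (Θ - γ - y) (Θ) (Θ + (x + y)) ((-1) * γ + (2) * Θ) (-(x + y + γ)) (-(x)) (y) (Θ - γ - (x + y)) (Θ - γ) (Θ + y) (-(Θ + x))
    (by refine ⟨⟨?_, ?_, ?_, ?_⟩, ⟨?_, ?_, ?_, ?_⟩, ?_, ?_, ?_, ?_⟩ <;> ring)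
  simp only [thetaf_neg] at h2
  linear_combination (norm := (field_simp; ring)) (1) * (thetaf τ (y) * thetaf τ (x) * thetaf τ (x + y + γ)) / (thetaf τ (Θ - γ) * thetaf τ (Θ - γ) * thetaf τ (Θ) * thetaf τ (Θ)) * h1
    + (1) * (thetaf τ (γ) * thetaf τ (γ) * thetaf τ (γ)) / (thetaf τ (Θ - γ) * thetaf τ (Θ - γ) * thetaf τ (Θ) * thetaf τ (Θ)) * h2

lemma yb_010_100 (τ γ x y Θ : ℂ) (hτ : 0 < τ.im) (h0 : thetaf τ Θ ≠ 0)
    (hp : thetaf τ (Θ + γ) ≠ 0) (hm : thetaf τ (Θ - γ) ≠ 0) :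
    ybL τ γ x y Θ 0 1 0 1 0 0 = ybR τ γ x y Θ 0 1 0 1 0 0 := by
  simp only [ybL, ybR, Fin.sum_univ_two, eps_zero, eps_one, Rdyn_0000, Rdyn_0001, Rdyn_0010, Rdyn_0011, Rdyn_0100, Rdyn_0101, Rdyn_0110, Rdyn_0111, Rdyn_1000, Rdyn_1001, Rdyn_1010, Rdyn_1011, Rdyn_1100, Rdyn_1101, Rdyn_1110, Rdyn_1111,
    mul_zero, zero_mul, add_zero, zero_add, mul_one, mul_neg, sub_neg_eq_add, sub_add_cancel, add_sub_cancel_right]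
  have h1 := three_gen τ hτ (((-1) * x + (-1) * γ + (2) * Θ) / 2) (((-1) * x + (-1) * γ) / 2) (((1) * x + (2) * y + (1) * γ) / 2) (((-1) * x + (1) * γ) / 2)
    (Θ - γ - x) (Θ) (y + γ) (x + y) (Θ + y) (Θ - γ - (x + y)) (-(x)) (-(γ)) (Θ - x) (Θ - γ) (y) (-(x + y + γ))
    (by refine ⟨⟨?_, ?_, ?_, ?_⟩, ⟨?_, ?_, ?_, ?_⟩, ?_, ?_, ?_, ?_⟩ <;> ring)
  simp only [thetaf_neg] at h1
  linear_combination (norm := (field_simp; ring)) (1) * (thetaf τ (γ) * thetaf τ (Θ + γ)) / (thetaf τ (Θ - γ) * thetaf τ (Θ) * thetaf τ (Θ)) * h1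

lemma yb_011_101 (τ γ x y Θ : ℂ) (hτ : 0 < τ.im) (h0 : thetaf τ Θ ≠ 0)
    (hp : thetaf τ (Θ + γ) ≠ 0) (hm : thetaf τ (Θ - γ) ≠ 0) :
    ybL τ γ x y Θ 0 1 1 1 0 1 = ybR τ γ x y Θ 0 1 1 1 0 1 := by
  simp only [ybL, ybR, Fin.sum_univ_two, eps_zero, eps_one, Rdyn_0000, Rdyn_0001, Rdyn_0010, Rdyn_0011, Rdyn_0100, Rdyn_0101, Rdyn_0110, Rdyn_0111, Rdyn_1000, Rdyn_1001, Rdyn_1010, Rdyn_1011, Rdyn_1100, Rdyn_1101, Rdyn_1110, Rdyn_1111,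
    mul_zero, zero_mul, add_zero, zero_add, mul_one, mul_neg, sub_neg_eq_add, sub_add_cancel, add_sub_cancel_right]
  have h1 := three_gen τ hτ (((-1) * x + (-1) * y + (1) * γ + (1) * Θ) / 2) (((-1) * x + (-1) * y + (-1) * γ + (1) * Θ) / 2) (((1) * x + (1) * y + (1) * γ + (1) * Θ) / 2) (((-1) * x + (1) * y + (1) * γ + (1) * Θ) / 2)
    (Θ - (x + y)) (γ) (Θ + γ + y) (x) (Θ + γ) (-(x + y)) (Θ - x) (-(y + γ)) (Θ + γ - x) (-(y)) (Θ) (-(x + y + γ))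
    (by refine ⟨⟨?_, ?_, ?_, ?_⟩, ⟨?_, ?_, ?_, ?_⟩, ?_, ?_, ?_, ?_⟩ <;> ring)
  simp only [thetaf_neg] at h1
  linear_combination (norm := (field_simp; ring)) (1) * (thetaf τ (Θ) * thetaf τ (γ)) / (thetaf τ (Θ + γ) * thetaf τ (Θ + γ) * thetaf τ (Θ)) * h1

lemma yb_011_110 (τ γ x y Θ : ℂ) (hτ : 0 < τ.im) (h0 : thetaf τ Θ ≠ 0)
    (hp : thetaf τ (Θ + γ) ≠ 0) (hm : thetaf τ (Θ - γ) ≠ 0) :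
    ybL τ γ x y Θ 0 1 1 1 1 0 = ybR τ γ x y Θ 0 1 1 1 1 0 := by
  simp only [ybL, ybR, Fin.sum_univ_two, eps_zero, eps_one, Rdyn_0000, Rdyn_0001, Rdyn_0010, Rdyn_0011, Rdyn_0100, Rdyn_0101, Rdyn_0110, Rdyn_0111, Rdyn_1000, Rdyn_1001, Rdyn_1010, Rdyn_1011, Rdyn_1100, Rdyn_1101, Rdyn_1110, Rdyn_1111,
    mul_zero, zero_mul, add_zero, zero_add, mul_one, mul_neg, sub_neg_eq_add, sub_add_cancel, add_sub_cancel_right]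
  have h1 := three_gen τ hτ (((-1) * x + (-1) * y + (2) * γ + (2) * Θ) / 2) (((-1) * x + (-1) * y + (-2) * γ) / 2) (((1) * x + (1) * y) / 2) (((-1) * x + (1) * y) / 2)
    (Θ - (x + y)) (Θ + γ + γ) (y) (x) (Θ + γ) (Θ + γ - (x + y)) (-(x + γ)) (-(y + γ)) (Θ + γ - x) (Θ + γ - y) (-(γ)) (-(x + y + γ))
    (by refine ⟨⟨?_, ?_, ?_, ?_⟩, ⟨?_, ?_, ?_, ?_⟩, ?_, ?_, ?_, ?_⟩ <;> ring)
  simp only [thetaf_neg] at h1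
  linear_combination (norm := (field_simp; ring)) (1) * (thetaf τ (Θ) * thetaf τ (γ)) / (thetaf τ (Θ + γ) * thetaf τ (Θ + γ) * thetaf τ (Θ)) * h1

lemma yb_100_001 (τ γ x y Θ : ℂ) (hτ : 0 < τ.im) (h0 : thetaf τ Θ ≠ 0)
    (hp : thetaf τ (Θ + γ) ≠ 0) (hm : thetaf τ (Θ - γ) ≠ 0) :
    ybL τ γ x y Θ 1 0 0 0 0 1 = ybR τ γ x y Θ 1 0 0 0 0 1 := by
  simp only [ybL, ybR, Fin.sum_univ_two, eps_zero, eps_one, Rdyn_0000, Rdyn_0001, Rdyn_0010, Rdyn_0011, Rdyn_0100, Rdyn_0101, Rdyn_0110, Rdyn_0111, Rdyn_1000, Rdyn_1001, Rdyn_1010, Rdyn_1011, Rdyn_1100, Rdyn_1101, Rdyn_1110, Rdyn_1111,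
    mul_zero, zero_mul, add_zero, zero_add, mul_one, mul_neg, sub_neg_eq_add, sub_add_cancel, add_sub_cancel_right]
  have h1 := three_gen τ hτ (((1) * y + (1) * Θ) / 2) (((-1) * y + (2) * γ + (-1) * Θ) / 2) (((2) * x + (1) * y + (1) * Θ) / 2) (((-1) * y + (-2) * γ + (1) * Θ) / 2)
    (γ) (Θ - γ + y) (Θ - γ + x) (x + y + γ) (Θ + (x + y)) (-(x)) (-(y)) (-(Θ - γ - γ)) (Θ - γ) (y + γ) (x + γ) (-(Θ - γ + (x + y)))
    (by refine ⟨⟨?_, ?_, ?_, ?_⟩, ⟨?_, ?_, ?_, ?_⟩, ?_, ?_, ?_, ?_⟩ <;> ring)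
  simp only [thetaf_neg] at h1
  linear_combination (norm := (field_simp; ring)) (1) * (thetaf τ (Θ) * thetaf τ (γ)) / (thetaf τ (Θ - γ) * thetaf τ (Θ - γ) * thetaf τ (Θ)) * h1

lemma yb_100_010 (τ γ x y Θ : ℂ) (hτ : 0 < τ.im) (h0 : thetaf τ Θ ≠ 0)
    (hp : thetaf τ (Θ + γ) ≠ 0) (hm : thetaf τ (Θ - γ) ≠ 0) :
    ybL τ γ x y Θ 1 0 0 0 1 0 = ybR τ γ x y Θ 1 0 0 0 1 0 := by
  simp only [ybL, ybR, Fin.sum_univ_two, eps_zero, eps_one, Rdyn_0000, Rdyn_0001, Rdyn_0010, Rdyn_0011, Rdyn_0100, Rdyn_0101, Rdyn_0110, Rdyn_0111, Rdyn_1000, Rdyn_1001, Rdyn_1010, Rdyn_1011, Rdyn_1100, Rdyn_1101, Rdyn_1110, Rdyn_1111,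
    mul_zero, zero_mul, add_zero, zero_add, mul_one, mul_neg, sub_neg_eq_add, sub_add_cancel, add_sub_cancel_right]
  have h1 := three_gen τ hτ (((1) * y + (1) * Θ) / 2) (((-1) * y + (1) * Θ) / 2) (((2) * x + (1) * y + (1) * Θ) / 2) (((-1) * y + (-2) * γ + (1) * Θ) / 2)
    (Θ) (y) (Θ - γ + x) (x + y + γ) (Θ + (x + y)) (-(x)) (Θ - γ - y) (γ) (Θ - γ) (y + γ) (Θ + x) (-(x + y))
    (by refine ⟨⟨?_, ?_, ?_, ?_⟩, ⟨?_, ?_, ?_, ?_⟩, ?_, ?_, ?_, ?_⟩ <;> ring)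
  simp only [thetaf_neg] at h1
  linear_combination (norm := (field_simp; ring)) (1) * (thetaf τ (Θ) * thetaf τ (γ)) / (thetaf τ (Θ - γ) * thetaf τ (Θ - γ) * thetaf τ (Θ)) * h1

lemma yb_101_011 (τ γ x y Θ : ℂ) (hτ : 0 < τ.im) (h0 : thetaf τ Θ ≠ 0)
    (hp : thetaf τ (Θ + γ) ≠ 0) (hm : thetaf τ (Θ - γ) ≠ 0) :
    ybL τ γ x y Θ 1 0 1 0 1 1 = ybR τ γ x y Θ 1 0 1 0 1 1 := by
  simp only [ybL, ybR, Fin.sum_univ_two, eps_zero, eps_one, Rdyn_0000, Rdyn_0001, Rdyn_0010, Rdyn_0011, Rdyn_0100, Rdyn_0101, Rdyn_0110, Rdyn_0111, Rdyn_1000, Rdyn_1001, Rdyn_1010, Rdyn_1011, Rdyn_1100, Rdyn_1101, Rdyn_1110, Rdyn_1111,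
    mul_zero, zero_mul, add_zero, zero_add, mul_one, mul_neg, sub_neg_eq_add, sub_add_cancel, add_sub_cancel_right]
  have h1 := three_gen τ hτ (((1) * y + (1) * γ + (1) * Θ) / 2) (((-1) * y + (-1) * γ + (1) * Θ) / 2) (((2) * x + (1) * y + (1) * γ + (1) * Θ) / 2) (((-1) * y + (1) * γ + (1) * Θ) / 2)
    (Θ) (y + γ) (Θ + γ + x) (x + y) (Θ + γ + (x + y)) (-(x)) (Θ - y) (-(γ)) (Θ + γ) (y) (Θ + x) (-(x + y + γ))
    (by refine ⟨⟨?_, ?_, ?_, ?_⟩, ⟨?_, ?_, ?_, ?_⟩, ?_, ?_, ?_, ?_⟩ <;> ring)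
  simp only [thetaf_neg] at h1
  linear_combination (norm := (field_simp; ring)) (1) * (thetaf τ (Θ - γ) * thetaf τ (γ)) / (thetaf τ (Θ + γ) * thetaf τ (Θ) * thetaf τ (Θ)) * h1

lemma yb_101_101 (τ γ x y Θ : ℂ) (hτ : 0 < τ.im) (h0 : thetaf τ Θ ≠ 0)
    (hp : thetaf τ (Θ + γ) ≠ 0) (hm : thetaf τ (Θ - γ) ≠ 0) :
    ybL τ γ x y Θ 1 0 1 1 0 1 = ybR τ γ x y Θ 1 0 1 1 0 1 := by
  simp only [ybL, ybR, Fin.sum_univ_two, eps_zero, eps_one, Rdyn_0000, Rdyn_0001, Rdyn_0010, Rdyn_0011, Rdyn_0100, Rdyn_0101, Rdyn_0110, Rdyn_0111, Rdyn_1000, Rdyn_1001, Rdyn_1010, Rdyn_1011, Rdyn_1100, Rdyn_1101, Rdyn_1110, Rdyn_1111,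
    mul_zero, zero_mul, add_zero, zero_add, mul_one, mul_neg, sub_neg_eq_add, sub_add_cancel, add_sub_cancel_right]
  have h1 := three_gen τ hτ (((-1) * x + (-1) * y + (2) * Θ) / 2) (((-1) * x + (-1) * y) / 2) (((1) * x + (1) * y + (2) * γ + (2) * Θ) / 2) (((-1) * x + (1) * y) / 2)
    (Θ - (x + y)) (Θ) (Θ + γ + y) (Θ + γ + x) ((1) * γ + (2) * Θ) (-(x + y + γ)) (-(x)) (-(y)) (Θ - x) (Θ - y) (Θ + γ) (-(Θ + γ + (x + y)))
    (by refine ⟨⟨?_, ?_, ?_, ?_⟩, ⟨?_, ?_, ?_, ?_⟩, ?_, ?_, ?_, ?_⟩ <;> ring)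
  simp only [thetaf_neg] at h1
  have h2 := three_gen τ hτ (((2) * Θ) / 2) 0 (((2) * γ + (2) * Θ) / 2) (((-2) * γ) / 2)
    (Θ) (Θ) (Θ) (Θ + γ + γ) ((1) * γ + (2) * Θ) (-(γ)) (-(γ)) (γ) (Θ - γ) (Θ + γ) (Θ + γ) (-(Θ + γ))
    (by refine ⟨⟨?_, ?_, ?_, ?_⟩, ⟨?_, ?_, ?_, ?_⟩, ?_, ?_, ?_, ?_⟩ <;> ring)
  simp only [thetaf_neg] at h2
  linear_combination (norm := (field_simp; ring)) (1) * (thetaf τ (γ) * thetaf τ (γ) * thetaf τ (γ)) / (thetaf τ (Θ + γ) * thetaf τ (Θ + γ) * thetaf τ (Θ) * thetaf τ (Θ)) * h1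
    + (1) * (thetaf τ (y) * thetaf τ (x) * thetaf τ (x + y + γ)) / (thetaf τ (Θ + γ) * thetaf τ (Θ + γ) * thetaf τ (Θ) * thetaf τ (Θ)) * h2

lemma yb_101_110 (τ γ x y Θ : ℂ) (hτ : 0 < τ.im) (h0 : thetaf τ Θ ≠ 0)
    (hp : thetaf τ (Θ + γ) ≠ 0) (hm : thetaf τ (Θ - γ) ≠ 0) :
    ybL τ γ x y Θ 1 0 1 1 1 0 = ybR τ γ x y Θ 1 0 1 1 1 0 := by
  simp only [ybL, ybR, Fin.sum_univ_two, eps_zero, eps_one, Rdyn_0000, Rdyn_0001, Rdyn_0010, Rdyn_0011, Rdyn_0100, Rdyn_0101, Rdyn_0110, Rdyn_0111, Rdyn_1000, Rdyn_1001, Rdyn_1010, Rdyn_1011, Rdyn_1100, Rdyn_1101, Rdyn_1110, Rdyn_1111,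
    mul_zero, zero_mul, add_zero, zero_add, mul_one, mul_neg, sub_neg_eq_add, sub_add_cancel, add_sub_cancel_right]
  have h1 := three_gen τ hτ (((-1) * x + (-1) * y + (1) * γ + (1) * Θ) / 2) (((-1) * x + (-1) * y + (-1) * γ + (1) * Θ) / 2) (((1) * x + (1) * y + (1) * γ + (1) * Θ) / 2) (((-1) * x + (1) * y + (-1) * γ + (-1) * Θ) / 2)
    (Θ - (x + y)) (γ) (y) (Θ + γ + x) (Θ + γ) (-(x + y)) (-(x + γ)) (Θ - y) (-(x)) (Θ + γ - y) (Θ) (-(x + y + γ))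
    (by refine ⟨⟨?_, ?_, ?_, ?_⟩, ⟨?_, ?_, ?_, ?_⟩, ?_, ?_, ?_, ?_⟩ <;> ring)
  simp only [thetaf_neg] at h1
  linear_combination (norm := (field_simp; ring)) (1) * (thetaf τ (γ) * thetaf τ (Θ + γ + γ)) / (thetaf τ (Θ + γ) * thetaf τ (Θ + γ) * thetaf τ (Θ)) * h1

lemma yb_110_011 (τ γ x y Θ : ℂ) (hτ : 0 < τ.im) (h0 : thetaf τ Θ ≠ 0)
    (hp : thetaf τ (Θ + γ) ≠ 0) (hm : thetaf τ (Θ - γ) ≠ 0) :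
    ybL τ γ x y Θ 1 1 0 0 1 1 = ybR τ γ x y Θ 1 1 0 0 1 1 := by
  simp only [ybL, ybR, Fin.sum_univ_two, eps_zero, eps_one, Rdyn_0000, Rdyn_0001, Rdyn_0010, Rdyn_0011, Rdyn_0100, Rdyn_0101, Rdyn_0110, Rdyn_0111, Rdyn_1000, Rdyn_1001, Rdyn_1010, Rdyn_1011, Rdyn_1100, Rdyn_1101, Rdyn_1110, Rdyn_1111,
    mul_zero, zero_mul, add_zero, zero_add, mul_one, mul_neg, sub_neg_eq_add, sub_add_cancel, add_sub_cancel_right]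
  have h1 := three_gen τ hτ (((1) * y + (1) * γ + (1) * Θ) / 2) (((-1) * y + (-1) * γ + (1) * Θ) / 2) (((2) * x + (1) * y + (1) * γ + (1) * Θ) / 2) (((-1) * y + (1) * γ + (-1) * Θ) / 2)
    (Θ) (y + γ) (x + γ) (Θ + (x + y)) (Θ + γ + (x + y)) (-(x)) (-(y)) (Θ - γ) (γ) (Θ + y) (Θ + x) (-(x + y + γ))
    (by refine ⟨⟨?_, ?_, ?_, ?_⟩, ⟨?_, ?_, ?_, ?_⟩, ?_, ?_, ?_, ?_⟩ <;> ring)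
  simp only [thetaf_neg] at h1
  linear_combination (norm := (field_simp; ring)) (1) * (thetaf τ (γ) * thetaf τ (Θ + γ)) / (thetaf τ (Θ) * thetaf τ (Θ) * thetaf τ (Θ + γ)) * h1

lemma yb_110_101 (τ γ x y Θ : ℂ) (hτ : 0 < τ.im) (h0 : thetaf τ Θ ≠ 0)
    (hp : thetaf τ (Θ + γ) ≠ 0) (hm : thetaf τ (Θ - γ) ≠ 0) :
    ybL τ γ x y Θ 1 1 0 1 0 1 = ybR τ γ x y Θ 1 1 0 1 0 1 := by
  simp only [ybL, ybR, Fin.sum_univ_two, eps_zero, eps_one, Rdyn_0000, Rdyn_0001, Rdyn_0010, Rdyn_0011, Rdyn_0100, Rdyn_0101, Rdyn_0110, Rdyn_0111, Rdyn_1000, Rdyn_1001, Rdyn_1010, Rdyn_1011, Rdyn_1100, Rdyn_1101, Rdyn_1110, Rdyn_1111,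
    mul_zero, zero_mul, add_zero, zero_add, mul_one, mul_neg, sub_neg_eq_add, sub_add_cancel, add_sub_cancel_right]
  have h1 := three_gen τ hτ (((1) * y + (1) * γ + (2) * Θ) / 2) (((-1) * y + (-1) * γ) / 2) (((2) * x + (1) * y + (1) * γ) / 2) (((-1) * y + (1) * γ) / 2)
    (Θ) (Θ + γ + y) (x + γ) (x + y) (Θ + γ + (x + y)) (Θ - x) (-(y)) (-(γ)) (Θ + γ) (Θ + y) (x) (-(x + y + γ))
    (by refine ⟨⟨?_, ?_, ?_, ?_⟩, ⟨?_, ?_, ?_, ?_⟩, ?_, ?_, ?_, ?_⟩ <;> ring)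
  simp only [thetaf_neg] at h1
  linear_combination (norm := (field_simp; ring)) (1) * (thetaf τ (γ) * thetaf τ (Θ + γ)) / (thetaf τ (Θ) * thetaf τ (Θ) * thetaf τ (Θ + γ)) * h1

lemma fin2_cases (a : Fin 2) : a = 0 ∨ a = 1 := by
  fin_cases a <;> simp

/-- The dynamical Yang-Baxter equation. -/
lemma dybe (τ γ x y Θ : ℂ) (hτ : 0 < τ.im) (h0 : thetaf τ Θ ≠ 0)
    (hp : thetaf τ (Θ + γ) ≠ 0) (hm : thetaf τ (Θ - γ) ≠ 0) (a b p e g q : Fin 2) :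
    ybL τ γ x y Θ a b p e g q = ybR τ γ x y Θ a b p e g q := by
  rcases fin2_cases a with rfl | rfl <;> rcases fin2_cases b with rfl | rfl <;>
  rcases fin2_cases p with rfl | rfl <;> rcases fin2_cases e with rfl | rfl <;>
  rcases fin2_cases g with rfl | rfl <;> rcases fin2_cases q with rfl | rfl
  all_goals first
    | with_reducible exact yb_001_010 τ γ x y Θ hτ h0 hp hm
    | with_reducible exact yb_001_100 τ γ x y Θ hτ h0 hp hm
    | with_reducible exact yb_010_001 τ γ x y Θ hτ h0 hp hm
    | with_reducible exact yb_010_010 τ γ x y Θ hτ h0 hp hm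
    | with_reducible exact yb_010_100 τ γ x y Θ hτ h0 hp hm
    | with_reducible exact yb_011_101 τ γ x y Θ hτ h0 hp hm
    | with_reducible exact yb_011_110 τ γ x y Θ hτ h0 hp hm
    | with_reducible exact yb_100_001 τ γ x y Θ hτ h0 hp hm
    | with_reducible exact yb_100_010 τ γ x y Θ hτ h0 hp hm
    | with_reducible exact yb_101_011 τ γ x y Θ hτ h0 hp hm
    | with_reducible exact yb_101_101 τ γ x y Θ hτ h0 hp hm
    | with_reducible exact yb_101_110 τ γ x y Θ hτ h0 hp hm
    | with_reducible exact yb_110_011 τ γ x y Θ hτ h0 hp hm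
    | with_reducible exact yb_110_101 τ γ x y Θ hτ h0 hp hm
    | (simp only [ybL, ybR, Fin.sum_univ_two, eps_zero, eps_one, Rdyn_0000, Rdyn_0001, Rdyn_0010, Rdyn_0011, Rdyn_0100, Rdyn_0101, Rdyn_0110, Rdyn_0111, Rdyn_1000, Rdyn_1001, Rdyn_1010, Rdyn_1011, Rdyn_1100, Rdyn_1101, Rdyn_1110, Rdyn_1111, mul_zero, zero_mul, add_zero, zero_add, mul_one, mul_neg, sub_neg_eq_add, sub_add_cancel, add_sub_cancel_right]
       first | done | field_simp)


/-- Total weight of a basis vector. -/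
def wt {L : ℕ} (p : Fin L → Fin 2) : ℂ := ∑ k, eps (p k)

lemma wt_cons {L : ℕ} (s : Fin 2) (p : Fin L → Fin 2) :
    wt (Fin.cons s p : Fin (L + 1) → Fin 2) = eps s + wt p := by
  simp [wt, Fin.sum_univ_succ]

lemma eps_int (s : Fin 2) : ∃ n : ℤ, eps s = n := by
  rcases fin2_cases s with rfl | rfl
  · exact ⟨1, by simp [eps_zero]⟩
  · exact ⟨-1, by simp [eps_one]⟩

lemma wt_int {L : ℕ} (p : Fin L → Fin 2) : ∃ n : ℤ, wt p = n := by
  choose g hg using eps_int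
  exact ⟨∑ k, g (p k), by simp [wt, hg]⟩

lemma sum_cons {L : ℕ} (F : (Fin (L + 1) → Fin 2) → ℂ) :
    ∑ r, F r = ∑ s : Fin 2, ∑ r' : Fin L → Fin 2, F (Fin.cons s r') := by
  rw [← Fintype.sum_prod_type']
  exact (Fintype.sum_equiv (Fin.consEquiv (fun _ : Fin (L + 1) => Fin 2))
    (fun x => F (Fin.cons x.1 x.2)) F (fun x => rfl)).symm

lemma sum_cons' {L : ℕ} (F : Fin 2 → Fin 2 → (Fin (L + 1) → Fin 2) → ℂ) :
    ∑ c, ∑ d, ∑ r, F c d r =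
      ∑ r' : Fin L → Fin 2, ∑ c, ∑ d, ∑ s : Fin 2, F c d (Fin.cons s r') := by
  simp only [sum_cons, Fin.sum_univ_two, Finset.sum_add_distrib]

/-- Adding a first site on which the operator acts trivially, as a function. -/
def embFun {L : ℕ} (M : Matrix (Fin 2 × (Fin L → Fin 2)) (Fin 2 × (Fin L → Fin 2)) ℂ) :
    Matrix (Fin 2 × (Fin (L + 1) → Fin 2)) (Fin 2 × (Fin (L + 1) → Fin 2)) ℂ :=
  fun p q => M (p.1, Fin.tail p.2) (q.1, Fin.tail q.2) * (if p.2 0 = q.2 0 then 1 else 0)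

/-- Adding a first site on which the operator acts trivially. -/
def emb {L : ℕ} : Matrix (Fin 2 × (Fin L → Fin 2)) (Fin 2 × (Fin L → Fin 2)) ℂ →*
    Matrix (Fin 2 × (Fin (L + 1) → Fin 2)) (Fin 2 × (Fin (L + 1) → Fin 2)) ℂ where
  toFun := embFun
  map_one' := by
    ext ⟨a, p⟩ ⟨b, q⟩
    simp only [embFun, Matrix.one_apply, Prod.mk.injEq]
    have h : p = q ↔ (Fin.tail p = Fin.tail q ∧ p 0 = q 0) := by
      constructor
      · rintro rfl; exact ⟨rfl, rfl⟩
      · rintro ⟨h1, h2⟩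
        rw [← Fin.cons_self_tail p, ← Fin.cons_self_tail q, h1, h2]
    simp only [h]
    by_cases h1 : a = b <;> by_cases h2 : Fin.tail p = Fin.tail q <;> simp [h1, h2]
  map_mul' M N := by
    refine Matrix.ext (fun ap bq => ?_)
    obtain ⟨a, p⟩ := ap
    obtain ⟨b, q⟩ := bq
    rw [Matrix.mul_apply]
    simp only [embFun, Matrix.mul_apply, Fintype.sum_prod_type, sum_cons, Fin.tail_cons, Fin.cons_zero]
    rw [Finset.sum_mul]
    refine Finset.sum_congr rfl (fun c _ => ?_)
    rw [Finset.sum_comm, Finset.sum_mul]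
    refine Finset.sum_congr rfl (fun r _ => ?_)
    rcases fin2_cases (p 0) with h | h <;> rcases fin2_cases (q 0) with h' | h' <;>
      simp [h, h', Fin.sum_univ_two]

lemma emb_apply {L : ℕ} (M : Matrix (Fin 2 × (Fin L → Fin 2)) (Fin 2 × (Fin L → Fin 2)) ℂ)
    (p q : Fin 2 × (Fin (L + 1) → Fin 2)) : emb M p q =
      M (p.1, Fin.tail p.2) (q.1, Fin.tail q.2) * (if p.2 0 = q.2 0 then 1 else 0) := rfl

lemma RaiDyn_succ (τ γ : ℂ) {L : ℕ} (lam θ : ℂ) (j : Fin L) :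
    RaiDyn τ γ lam θ j.succ = emb (RaiDyn τ γ lam θ j) := by
  ext ⟨a, p⟩ ⟨b, q⟩
  have h1 : ∑ k ∈ Finset.univ.filter (fun k : Fin (L + 1) => j.succ < k), eps (q k)
      = ∑ k ∈ Finset.univ.filter (fun k : Fin L => j < k), eps (Fin.tail q k) := by
    simp only [Finset.sum_filter]
    rw [Fin.sum_univ_succ]
    simp [Fin.tail]
  have h2 : (∀ k, k ≠ j.succ → p k = q k) ↔
      ((∀ k, k ≠ j → Fin.tail p k = Fin.tail q k) ∧ p 0 = q 0) := by
    rw [Fin.forall_fin_succ]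
    simp only [Fin.tail, ne_eq, Fin.succ_inj]
    constructor
    · rintro ⟨h, h'⟩
      exact ⟨h', h (Fin.succ_ne_zero j).symm⟩
    · rintro ⟨h, h'⟩
      exact ⟨fun _ => h', h⟩
  change _ = RaiDyn τ γ lam θ j (a, Fin.tail p) (b, Fin.tail q) * (if p 0 = q 0 then 1 else 0)
  simp only [RaiDyn, h1, h2]
  rw [ite_and, mul_assoc]
  by_cases hA : ∀ k, k ≠ j → Fin.tail p k = Fin.tail q k
  · simp only [if_pos hA, one_mul]; rfl
  · simp only [if_neg hA, zero_mul, mul_zero]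

lemma Tdyn_succ (τ γ : ℂ) {L : ℕ} (μ : Fin (L + 1) → ℂ) (lam θ : ℂ) :
    Tdyn τ γ μ lam θ = RaiDyn τ γ (lam - μ 0) θ 0 * emb (Tdyn τ γ (Fin.tail μ) lam θ) := by
  simp only [Tdyn, List.ofFn_succ, List.prod_cons, RaiDyn_succ, map_list_prod, List.map_ofFn]
  rfl

lemma Tdyn_cons (τ γ : ℂ) {L : ℕ} (μ : Fin (L + 1) → ℂ) (lam θ : ℂ) (a b p0 q0 : Fin 2)
    (p q : Fin L → Fin 2) :
    Tdyn τ γ μ lam θ (a, Fin.cons p0 p) (b, Fin.cons q0 q) =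
      ∑ c, Rdyn τ γ (lam - μ 0) (θ - γ * wt p) (a, p0) (c, q0) *
        Tdyn τ γ (Fin.tail μ) lam θ (c, p) (b, q) := by
  rw [Tdyn_succ, Matrix.mul_apply, Fintype.sum_prod_type]
  refine Finset.sum_congr rfl (fun c _ => ?_)
  rw [Finset.sum_eq_single (Fin.cons q0 p)]
  · have h1 : ∑ k ∈ Finset.univ.filter (fun k : Fin (L + 1) => 0 < k),
        eps ((Fin.cons q0 p : Fin (L + 1) → Fin 2) k) = wt p := by
      simp only [Finset.sum_filter]
      rw [Fin.sum_univ_succ]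
      simp [wt]
    have h2 : ∀ k : Fin (L + 1), k ≠ 0 →
        (Fin.cons p0 p : Fin (L + 1) → Fin 2) k = (Fin.cons q0 p : Fin (L + 1) → Fin 2) k := by
      intro k hk
      obtain ⟨j, rfl⟩ := Fin.exists_succ_eq.mpr hk
      simp
    simp only [RaiDyn, h1, if_pos h2, emb_apply, Fin.tail_cons,
      Fin.cons_zero, mul_one, if_true]
  · intro r _ hr
    by_cases h0 : r 0 = q0
    · have h2 : ¬ ∀ k : Fin (L + 1), k ≠ 0 →
          (Fin.cons p0 p : Fin (L + 1) → Fin 2) k = r k := by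
        intro h
        apply hr
        funext k
        refine Fin.cases ?_ (fun j => ?_) k
        · simpa using h0
        · have := h j.succ (Fin.succ_ne_zero j)
          simpa using this.symm
      simp only [RaiDyn, if_neg h2, mul_zero, zero_mul]
    · simp only [emb_apply, Fin.cons_zero, if_neg h0, mul_zero]
  · intro h; exact absurd (Finset.mem_univ _) h

lemma Tdyn_zero (τ γ : ℂ) (μ : Fin 0 → ℂ) (lam θ : ℂ) (a b : Fin 2) (p q : Fin 0 → Fin 2) :
    Tdyn τ γ μ lam θ (a, p) (b, q) = if a = b then 1 else 0 := by
  have : p = q := Subsingleton.elim _ _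
  subst this
  simp [Tdyn, Matrix.one_apply]

lemma Rdyn_weight (τ γ lam θ : ℂ) (a b c d : Fin 2) (h : Rdyn τ γ lam θ (a, b) (c, d) ≠ 0) :
    eps a + eps b = eps c + eps d := by
  revert h
  rcases fin2_cases a with rfl | rfl <;> rcases fin2_cases b with rfl | rfl <;>
  rcases fin2_cases c with rfl | rfl <;> rcases fin2_cases d with rfl | rfl <;>
  simp [Rdyn, eps]

lemma Tdyn_weight (τ γ : ℂ) {L : ℕ} (μ : Fin L → ℂ) (lam θ : ℂ) (a b : Fin 2)
    (p q : Fin L → Fin 2) (h : Tdyn τ γ μ lam θ (a, p) (b, q) ≠ 0) :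
    eps a + wt p = eps b + wt q := by
  induction L generalizing a b with
  | zero =>
    rw [Tdyn_zero] at h
    have hab : a = b := by
      by_contra hne
      simp [hne] at h
    have : p = q := Subsingleton.elim _ _
    rw [hab, this]
  | succ L ih =>
    rw [← Fin.cons_self_tail p, ← Fin.cons_self_tail q] at h ⊢
    rw [Tdyn_cons] at h
    obtain ⟨c, _, hc⟩ := Finset.exists_ne_zero_of_sum_ne_zero h
    have h1 := Rdyn_weight _ _ _ _ _ _ _ _ (left_ne_zero_of_mul hc)
    have h2 := ih _ _ _ _ _ (right_ne_zero_of_mul hc)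
    rw [wt_cons, wt_cons]
    linear_combination h1 + h2

lemma Tdyn_shift (τ γ : ℂ) {L : ℕ} (μ : Fin L → ℂ) (lam θ θ' : ℂ) (a b : Fin 2)
    (p q : Fin L → Fin 2) (F : ℂ → ℂ) :
    F (θ' - γ * eps b - γ * wt q) * Tdyn τ γ μ lam θ (a, p) (b, q) =
      F (θ' - γ * wt p - γ * eps a) * Tdyn τ γ μ lam θ (a, p) (b, q) := by
  by_cases h : Tdyn τ γ μ lam θ (a, p) (b, q) = 0
  · simp [h]
  · have h1 := Tdyn_weight τ γ μ lam θ a b p q h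
    congr 2
    linear_combination γ * h1

/-- The genericity condition on the dynamical parameter. -/
def Gen (τ γ θ : ℂ) : Prop := ∀ k : ℤ, thetaf τ (θ + γ * k) ≠ 0

lemma Gen.shift {τ γ θ : ℂ} (h : Gen τ γ θ) (m : ℤ) (θ' : ℂ) (e : θ' = θ + γ * m) :
    Gen τ γ θ' := by
  intro k
  have := h (m + k)
  rw [e]
  convert this using 2
  push_cast
  ring

lemma Gen.ne {τ γ θ : ℂ} (h : Gen τ γ θ) (m : ℤ) (θ' : ℂ) (e : θ' = θ + γ * m) :
    thetaf τ θ' ≠ 0 := e ▸ h m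

/-- The dynamical RTT relation. -/
lemma rtt (τ γ : ℂ) (hτ : 0 < τ.im) (l1 l2 : ℂ) {L : ℕ} (μ : Fin L → ℂ) (θ : ℂ)
    (hθ : Gen τ γ θ) (a b a' b' : Fin 2) (p q : Fin L → Fin 2) :
    ∑ c, ∑ d, ∑ r, Rdyn τ γ (l1 - l2) (θ - γ * wt p) (a, b) (c, d) *
        Tdyn τ γ μ l1 θ (c, p) (a', r) * Tdyn τ γ μ l2 (θ - γ * eps a') (d, r) (b', q) =
    ∑ c, ∑ d, ∑ r, Tdyn τ γ μ l2 θ (b, p) (d, r) *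
        Tdyn τ γ μ l1 (θ - γ * eps d) (a, r) (c, q) * Rdyn τ γ (l1 - l2) θ (c, d) (a', b') := by
  induction L generalizing a b with
  | zero =>
    simp only [Tdyn_zero, wt]
    rcases fin2_cases a with rfl | rfl <;> rcases fin2_cases b with rfl | rfl <;>
    rcases fin2_cases a' with rfl | rfl <;> rcases fin2_cases b' with rfl | rfl <;>
    simp [Fin.sum_univ_two]
  | succ L ih =>
    rw [← Fin.cons_self_tail p, ← Fin.cons_self_tail q]
    generalize p 0 = p0
    generalize q 0 = q0
    generalize Fin.tail p = p'
    generalize Fin.tail q = q'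
    clear p q
    rw [sum_cons', sum_cons']
    simp only [Tdyn_cons, wt_cons]
    generalize hμ : Fin.tail μ = μ'
    generalize μ 0 = μ0
    obtain ⟨m, hm⟩ := wt_int p'
    have hy : l1 - μ0 = (l1 - l2) + (l2 - μ0) := by ring
    have key := fun a b p e g q => dybe τ γ (l1 - l2) (l2 - μ0) (θ - γ * wt p') hτ
      (hθ.ne (-m) _ (by rw [hm]; push_cast; ring)) (hθ.ne (-m + 1) _ (by rw [hm]; push_cast; ring))
      (hθ.ne (-m - 1) _ (by rw [hm]; push_cast; ring)) a b p e g q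
    have hp0 : θ - γ * (eps p0 + wt p') = θ - γ * wt p' - γ * eps p0 := by ring
    have step1 : ∀ r' : Fin L → Fin 2,
        (∑ c, ∑ d, ∑ s, Rdyn τ γ (l1 - l2) (θ - γ * (eps p0 + wt p')) (a, b) (c, d) *
          (∑ e, Rdyn τ γ (l1 - μ0) (θ - γ * wt p') (c, p0) (e, s) *
            Tdyn τ γ μ' l1 θ (e, p') (a', r')) *
          (∑ g, Rdyn τ γ (l2 - μ0) (θ - γ * eps a' - γ * wt r') (d, s) (g, q0) *
            Tdyn τ γ μ' l2 (θ - γ * eps a') (g, r') (b', q'))) =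
        ∑ c, ∑ d, ∑ s, Rdyn τ γ (l2 - μ0) (θ - γ * wt p') (b, p0) (d, s) *
          Rdyn τ γ (l1 - μ0) (θ - γ * wt p' - γ * eps d) (a, s) (c, q0) *
          (∑ e, ∑ g, Rdyn τ γ (l1 - l2) (θ - γ * wt p') (c, d) (e, g) *
            Tdyn τ γ μ' l1 θ (e, p') (a', r') *
            Tdyn τ γ μ' l2 (θ - γ * eps a') (g, r') (b', q')) := by
      intro r'
      have hs : ∀ c d s e g : Fin 2, Rdyn τ γ (l1 - μ0) (θ - γ * wt p') (c, p0) (e, s) *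
            Tdyn τ γ μ' l1 θ (e, p') (a', r') *
            Rdyn τ γ (l2 - μ0) (θ - γ * eps a' - γ * wt r') (d, s) (g, q0) =
            Rdyn τ γ (l1 - μ0) (θ - γ * wt p') (c, p0) (e, s) *
            Tdyn τ γ μ' l1 θ (e, p') (a', r') *
            Rdyn τ γ (l2 - μ0) (θ - γ * wt p' - γ * eps e) (d, s) (g, q0) := by
        intro c d s e g
        linear_combination Rdyn τ γ (l1 - μ0) (θ - γ * wt p') (c, p0) (e, s) *
          Tdyn_shift τ γ μ' l1 θ θ e a' p' r' (fun z => Rdyn τ γ (l2 - μ0) z (d, s) (g, q0))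
      trans ∑ e, ∑ g, ybL τ γ (l1 - l2) (l2 - μ0) (θ - γ * wt p') a b p0 e g q0 *
            Tdyn τ γ μ' l1 θ (e, p') (a', r') *
            Tdyn τ γ μ' l2 (θ - γ * eps a') (g, r') (b', q')
      · trans ∑ c, ∑ d, ∑ s, ∑ e, ∑ g,
          Rdyn τ γ (l1 - l2) (θ - γ * wt p' - γ * eps p0) (a, b) (c, d) *
          (Rdyn τ γ (l1 - μ0) (θ - γ * wt p') (c, p0) (e, s) *
            Tdyn τ γ μ' l1 θ (e, p') (a', r') *
            Rdyn τ γ (l2 - μ0) (θ - γ * wt p' - γ * eps e) (d, s) (g, q0)) *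
            Tdyn τ γ μ' l2 (θ - γ * eps a') (g, r') (b', q')
        · simp only [← hs, hp0]
          refine Finset.sum_congr rfl (fun c _ => Finset.sum_congr rfl (fun d _ =>
            Finset.sum_congr rfl (fun s _ => ?_)))
          simp only [Fin.sum_univ_two]
          ring
        · simp only [ybL, Fin.sum_univ_two, hy]
          ring
      · simp only [key]
        simp only [ybR, Fin.sum_univ_two, hy]
        ring
    have step2 : ∀ r' : Fin L → Fin 2,
        (∑ c', ∑ d', ∑ s, (∑ d, Rdyn τ γ (l2 - μ0) (θ - γ * wt p') (b, p0) (d, s) *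
            Tdyn τ γ μ' l2 θ (d, p') (d', r')) *
          (∑ c, Rdyn τ γ (l1 - μ0) (θ - γ * eps d' - γ * wt r') (a, s) (c, q0) *
            Tdyn τ γ μ' l1 (θ - γ * eps d') (c, r') (c', q')) *
          Rdyn τ γ (l1 - l2) θ (c', d') (a', b')) =
        ∑ c, ∑ d, ∑ s, Rdyn τ γ (l2 - μ0) (θ - γ * wt p') (b, p0) (d, s) *
          Rdyn τ γ (l1 - μ0) (θ - γ * wt p' - γ * eps d) (a, s) (c, q0) *
          (∑ c', ∑ d', Tdyn τ γ μ' l2 θ (d, p') (d', r') *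
            Tdyn τ γ μ' l1 (θ - γ * eps d') (c, r') (c', q') *
            Rdyn τ γ (l1 - l2) θ (c', d') (a', b')) := by
      intro r'
      have hs : ∀ c d s d' : Fin 2,
            Rdyn τ γ (l1 - μ0) (θ - γ * eps d' - γ * wt r') (a, s) (c, q0) *
            Tdyn τ γ μ' l2 θ (d, p') (d', r') =
            Rdyn τ γ (l1 - μ0) (θ - γ * wt p' - γ * eps d) (a, s) (c, q0) *
            Tdyn τ γ μ' l2 θ (d, p') (d', r') := by
        intro c d s d'
        exact Tdyn_shift τ γ μ' l2 θ θ d d' p' r' (fun z => Rdyn τ γ (l1 - μ0) z (a, s) (c, q0))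
      trans ∑ c', ∑ d', ∑ s, ∑ d, ∑ c, Rdyn τ γ (l2 - μ0) (θ - γ * wt p') (b, p0) (d, s) *
            (Rdyn τ γ (l1 - μ0) (θ - γ * wt p' - γ * eps d) (a, s) (c, q0) *
            Tdyn τ γ μ' l2 θ (d, p') (d', r')) *
            Tdyn τ γ μ' l1 (θ - γ * eps d') (c, r') (c', q') *
          Rdyn τ γ (l1 - l2) θ (c', d') (a', b')
      · simp only [← hs]
        refine Finset.sum_congr rfl (fun c _ => Finset.sum_congr rfl (fun d _ =>
            Finset.sum_congr rfl (fun s _ => ?_)))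
        simp only [Fin.sum_univ_two]
        ring
      · simp only [Fin.sum_univ_two]
        ring
    simp only [step1, step2]
    have pull : ∀ (A : Fin 2 → Fin 2 → Fin 2 → ℂ)
        (B : (Fin L → Fin 2) → Fin 2 → Fin 2 → Fin 2 → Fin 2 → ℂ),
        ∑ r', ∑ c, ∑ d, ∑ s, A c d s * (∑ e, ∑ g, B r' c d e g) =
        ∑ c, ∑ d, ∑ s, A c d s * (∑ e, ∑ g, ∑ r', B r' c d e g) := by
      intro A B
      simp only [Fin.sum_univ_two, Finset.sum_add_distrib, Finset.mul_sum, mul_add]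
    rw [pull (fun c d s => Rdyn τ γ (l2 - μ0) (θ - γ * wt p') (b, p0) (d, s) *
          Rdyn τ γ (l1 - μ0) (θ - γ * wt p' - γ * eps d) (a, s) (c, q0)),
      pull (fun c d s => Rdyn τ γ (l2 - μ0) (θ - γ * wt p') (b, p0) (d, s) *
          Rdyn τ γ (l1 - μ0) (θ - γ * wt p' - γ * eps d) (a, s) (c, q0))]
    refine Finset.sum_congr rfl (fun c _ => Finset.sum_congr rfl (fun d _ =>
            Finset.sum_congr rfl (fun s _ => ?_)))
    rw [ih]


lemma Adyn_apply (τ γ : ℂ) {L : ℕ} (μ : Fin L → ℂ) (lam θ : ℂ) (p q : Fin L → Fin 2) :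
    Adyn τ γ μ lam θ p q = Tdyn τ γ μ lam θ (0, p) (0, q) := rfl

lemma Bdyn_apply (τ γ : ℂ) {L : ℕ} (μ : Fin L → ℂ) (lam θ : ℂ) (p q : Fin L → Fin 2) :
    Bdyn τ γ μ lam θ p q = Tdyn τ γ μ lam θ (0, p) (1, q) := rfl

lemma exchange_AB (τ γ : ℂ) (hτ : 0 < τ.im) {L : ℕ} (μ : Fin L → ℂ) (l0 l1 θ : ℂ)
    (hθ : Gen τ γ θ) (h10 : thetaf τ (l1 - l0) ≠ 0) :
    Adyn τ γ μ l0 (θ + γ) * Bdyn τ γ μ l1 θ =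
      (thetaf τ (θ + γ) / thetaf τ (θ + γ + γ) * (thetaf τ (l1 - l0 + γ) / thetaf τ (l1 - l0))) •
        (Bdyn τ γ μ l1 (θ + γ) * Adyn τ γ μ l0 (θ + γ + γ)) -
      (thetaf τ (θ + γ - l1 + l0) / thetaf τ (θ + γ + γ) * (thetaf τ γ / thetaf τ (l1 - l0))) •
        (Bdyn τ γ μ l0 (θ + γ) * Adyn τ γ μ l1 (θ + γ + γ)) := by
  ext p q
  have h1 : thetaf τ (θ + γ) ≠ 0 := hθ.ne 1 _ (by push_cast; ring)
  have h2 : thetaf τ (θ + γ + γ) ≠ 0 := hθ.ne 2 _ (by push_cast; ring)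
  have h := rtt τ γ hτ l1 l0 μ (θ + γ) (hθ.shift 1 _ (by push_cast; ring)) 0 0 1 0 p q
  have e1 : θ + γ - (l1 - l0) = θ + γ - l1 + l0 := by ring
  simp only [Fin.sum_univ_two, Rdyn_0000, Rdyn_0001, Rdyn_0010, Rdyn_0011, Rdyn_0110, Rdyn_1010,
    Rdyn_1110, zero_mul, mul_zero, Finset.sum_const_zero, add_zero, zero_add, eps_zero, eps_one,
    mul_one, mul_neg, sub_neg_eq_add, add_sub_cancel_right, e1] at h
  rw [← Finset.sum_mul, ← Finset.sum_mul] at h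
  simp only [mul_assoc, ← Finset.mul_sum] at h
  rw [Matrix.sub_apply, Matrix.smul_apply, Matrix.smul_apply, Matrix.mul_apply, Matrix.mul_apply,
    Matrix.mul_apply]
  simp only [smul_eq_mul, Adyn_apply, Bdyn_apply]
  generalize (∑ x, Tdyn τ γ μ l0 (θ + γ) (0, p) (0, x) * Tdyn τ γ μ l1 θ (0, x) (1, q)) = X at *
  generalize (∑ x, Tdyn τ γ μ l1 (θ + γ) (0, p) (1, x) *
    Tdyn τ γ μ l0 (θ + γ + γ) (0, x) (0, q)) = Y at *
  generalize (∑ x, Tdyn τ γ μ l0 (θ + γ) (0, p) (1, x) *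
    Tdyn τ γ μ l1 (θ + γ + γ) (0, x) (0, q)) = Z at *
  field_simp at h ⊢
  linear_combination -h

lemma Tdyn_continuous (τ γ : ℂ) (hτ : 0 < τ.im) {L : ℕ} (μ : Fin L → ℂ) (θ : ℂ) (a b : Fin 2)
    (p q : Fin L → Fin 2) : Continuous (fun lam => Tdyn τ γ μ lam θ (a, p) (b, q)) := by
  have hf : Continuous (thetaf τ) := (thetaf_differentiable τ hτ).continuous
  induction L generalizing a b with
  | zero => simp only [Tdyn_zero]; fun_prop
  | succ L ih =>
    rw [← Fin.cons_self_tail p, ← Fin.cons_self_tail q]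
    simp only [Tdyn_cons]
    refine continuous_finsetSum _ (fun c _ => ?_)
    refine Continuous.mul ?_ (ih _ _ _ _ _)
    unfold Rdyn
    simp only [div_eq_mul_inv]
    split_ifs <;> fun_prop

lemma thetaf_eventually_ne (τ : ℂ) (hτ : 0 < τ.im) (w : ℂ) (hw : thetaf τ w ≠ 0) (z : ℂ) :
    ∀ᶠ x in nhdsWithin z {z}ᶜ, thetaf τ x ≠ 0 := by
  have han : AnalyticOnNhd ℂ (thetaf τ) Set.univ :=
    (thetaf_differentiable τ hτ).differentiableOn.analyticOnNhd isOpen_univ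
  rcases (han z (Set.mem_univ z)).eventually_eq_zero_or_eventually_ne_zero with h | h
  · exact absurd (han.eqOn_zero_of_preconnected_of_eventuallyEq_zero isPreconnected_univ
      (Set.mem_univ z) h (Set.mem_univ w)) hw
  · exact h

lemma exchange_BB (τ γ : ℂ) (hτ : 0 < τ.im) {L : ℕ} (μ : Fin L → ℂ) (l1 l2 θ : ℂ)
    (hθ : Gen τ γ θ) :
    Bdyn τ γ μ l1 θ * Bdyn τ γ μ l2 (θ + γ) = Bdyn τ γ μ l2 θ * Bdyn τ γ μ l1 (θ + γ) := by
  ext p q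
  have key : ∀ z : ℂ, thetaf τ (z + l1 - l2 + γ) ≠ 0 →
      (Bdyn τ γ μ (z + l1) θ * Bdyn τ γ μ l2 (θ + γ)) p q =
      (Bdyn τ γ μ l2 θ * Bdyn τ γ μ (z + l1) (θ + γ)) p q := by
    intro z hz
    have h := rtt τ γ hτ (z + l1) l2 μ θ hθ 0 0 1 1 p q
    simp only [Fin.sum_univ_two, Rdyn_0000, Rdyn_0001, Rdyn_0010, Rdyn_0011, Rdyn_0111, Rdyn_1011,
      Rdyn_1111, zero_mul, mul_zero, Finset.sum_const_zero, add_zero, zero_add, eps_zero, eps_one,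
      mul_one, mul_neg, sub_neg_eq_add] at h
    rw [← Finset.sum_mul] at h
    simp only [mul_assoc, ← Finset.mul_sum] at h
    simp only [Matrix.mul_apply, Bdyn_apply]
    apply mul_left_cancel₀ hz
    rw [h, mul_comm]
  have hc : ∀ θ p q, Continuous (fun z => Bdyn τ γ μ (z + l1) θ p q) := by
    intro θ p q
    exact (Tdyn_continuous τ γ hτ μ θ 0 1 p q).comp (by fun_prop : Continuous fun z : ℂ => z + l1)
  have c1 : Continuous (fun z => (Bdyn τ γ μ (z + l1) θ * Bdyn τ γ μ l2 (θ + γ)) p q) := by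
    simp only [Matrix.mul_apply]
    exact continuous_finsetSum _ (fun r _ => (hc _ _ _).mul continuous_const)
  have c2 : Continuous (fun z => (Bdyn τ γ μ l2 θ * Bdyn τ γ μ (z + l1) (θ + γ)) p q) := by
    simp only [Matrix.mul_apply]
    exact continuous_finsetSum _ (fun r _ => continuous_const.mul (hc _ _ _))
  have hne : ∀ᶠ x in nhdsWithin (0 : ℂ) {0}ᶜ, thetaf τ (x + l1 - l2 + γ) ≠ 0 := by
    have h := thetaf_eventually_ne τ hτ _ (hθ 0) (l1 - l2 + γ)
    have ht : Filter.Tendsto (fun x : ℂ => x + l1 - l2 + γ) (nhdsWithin (0 : ℂ) {0}ᶜ)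
        (nhdsWithin (l1 - l2 + γ) {l1 - l2 + γ}ᶜ) := by
      apply tendsto_nhdsWithin_of_tendsto_nhds_of_eventually_within
      · have : Continuous (fun x : ℂ => x + l1 - l2 + γ) := by fun_prop
        have h0 := this.tendsto 0
        simp only [zero_add] at h0
        exact h0.mono_left nhdsWithin_le_nhds
      · filter_upwards [self_mem_nhdsWithin] with x hx
        intro hx'
        apply hx
        simp only [Set.mem_singleton_iff] at hx' ⊢
        linear_combination hx'
    exact ht.eventually h
  have t1 : Filter.Tendsto (fun z => (Bdyn τ γ μ (z + l1) θ * Bdyn τ γ μ l2 (θ + γ)) p q)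
      (nhdsWithin (0 : ℂ) {0}ᶜ)
      (nhds ((Bdyn τ γ μ (0 + l1) θ * Bdyn τ γ μ l2 (θ + γ)) p q)) :=
    (c1.tendsto 0).mono_left nhdsWithin_le_nhds
  have t2 : Filter.Tendsto (fun z => (Bdyn τ γ μ l2 θ * Bdyn τ γ μ (z + l1) (θ + γ)) p q)
      (nhdsWithin (0 : ℂ) {0}ᶜ)
      (nhds ((Bdyn τ γ μ l2 θ * Bdyn τ γ μ (0 + l1) (θ + γ)) p q)) :=
    (c2.tendsto 0).mono_left nhdsWithin_le_nhds
  have t3 := t1.congr' (hne.mono key)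
  have := tendsto_nhds_unique t3 t2
  simpa only [zero_add] using this

lemma Ydyn_succ (τ γ : ℂ) {L : ℕ} (μ : Fin L → ℂ) (θ : ℂ) {n : ℕ} (ν : Fin (n + 1) → ℂ) :
    Ydyn τ γ μ θ ν = Bdyn τ γ μ (ν 0) (θ + γ) * Ydyn τ γ μ (θ + γ) (fun i => ν i.succ) := by
  have e0 : θ + ((((0 : Fin (n + 1)) : ℕ) : ℂ) + 1) * γ = θ + γ := by simp
  have e1 : ∀ i : Fin n, θ + (((i.succ : ℕ) : ℂ) + 1) * γ = θ + γ + (((i : ℕ) : ℂ) + 1) * γ := by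
    intro i
    rw [Fin.val_succ]
    push_cast
    ring
  simp only [Ydyn, List.ofFn_succ (n := n), List.prod_cons, e0, e1]

lemma swap_Y (τ γ : ℂ) (hτ : 0 < τ.im) {L : ℕ} (μ : Fin L → ℂ) (l0 l1 θ : ℂ)
    (hθ : Gen τ γ θ) {n : ℕ} (t : Fin n → ℂ) (k : Fin n) :
    Bdyn τ γ μ l1 θ * Ydyn τ γ μ θ (Fin.cons l0 t ∘ Fin.succAbove k.succ) =
    Bdyn τ γ μ l0 θ * Ydyn τ γ μ θ (Fin.cons l1 t ∘ Fin.succAbove k.succ) := by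
  cases n with
  | zero => exact k.elim0
  | succ m =>
    rw [Ydyn_succ, Ydyn_succ, ← mul_assoc, ← mul_assoc]
    have e : ∀ l : ℂ, ((Fin.cons l t : Fin (m + 2) → ℂ) ∘ Fin.succAbove k.succ) 0 = l := by
      intro l
      simp
    have e' : ∀ l : ℂ, (fun i : Fin m => ((Fin.cons l t : Fin (m + 2) → ℂ) ∘
        Fin.succAbove k.succ) i.succ) = t ∘ Fin.succAbove k := by
      intro l
      funext i
      simp
    rw [e, e, e', e', exchange_BB τ γ hτ μ l1 l0 θ hθ]

lemma coef_identity (τ γ : ℂ) (hτ : 0 < τ.im) (T l0 l1 t N P : ℂ)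
    (hT : thetaf τ (T + γ) ≠ 0) (h10 : thetaf τ (l1 - l0) ≠ 0)
    (ht0 : thetaf τ (t - l0) ≠ 0) (ht1 : thetaf τ (t - l1) ≠ 0) :
    thetaf τ T / thetaf τ (T + γ) * (thetaf τ (l1 - l0 + γ) / thetaf τ (l1 - l0)) *
      (thetaf τ (T + γ - t + l0) / N * (thetaf τ γ / thetaf τ (t - l0)) * P) -
    thetaf τ (T - l1 + l0) / thetaf τ (T + γ) * (thetaf τ γ / thetaf τ (l1 - l0)) *
      (thetaf τ (T + γ - t + l1) / N * (thetaf τ γ / thetaf τ (t - l1)) * P) =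
    thetaf τ (T - t + l0) / N * (thetaf τ γ / thetaf τ (t - l0)) *
      (thetaf τ (l1 - t + γ) / thetaf τ (l1 - t) * P) := by
  have h := three_gen τ hτ ((2 * T + γ - (t - l0)) / 2) ((t - l0 - γ) / 2) ((t - l0 + γ) / 2)
    ((2 * (l1 - l0) + γ - (t - l0)) / 2)
    T (T + γ - t + l0) (l1 - l0 + γ) (t - l1) (T + γ) (T - t + l0) (l1 - l0) (-(l1 - t + γ))
    (T + γ - t + l1) (T - l1 + l0) (t - l0) (-γ)
    (by refine ⟨⟨?_, ?_, ?_, ?_⟩, ⟨?_, ?_, ?_, ?_⟩, ?_, ?_, ?_, ?_⟩ <;> ring)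
  have e : thetaf τ (l1 - t) = - thetaf τ (t - l1) := by
    rw [← thetaf_neg]; congr 1; ring
  simp only [thetaf_neg] at h
  rw [e]
  by_cases hN : N = 0
  · simp [hN]
  · field_simp
    linear_combination (thetaf τ γ * P) * h

lemma prod_erase_zero {n : ℕ} (g : Fin (n + 1) → ℂ) :
    ∏ j ∈ Finset.univ.erase 0, g j = ∏ j : Fin n, g j.succ := by
  have h : ∏ j ∈ Finset.univ.erase (0 : Fin (n + 1)), g j
      = ∏ j : Fin (n + 1), if j = 0 then 1 else g j := by
    rw [Finset.prod_ite, Finset.prod_const_one, one_mul]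
    congr 1
    ext j; simp
  rw [h, Fin.prod_univ_succ]
  simp

lemma prod_erase_succ {n : ℕ} (g : Fin (n + 1) → ℂ) (k : Fin n) :
    ∏ j ∈ Finset.univ.erase k.succ, g j = g 0 * ∏ j ∈ Finset.univ.erase k, g j.succ := by
  have h : ∀ {m : ℕ} (i : Fin m) (g : Fin m → ℂ), ∏ j ∈ Finset.univ.erase i, g j
      = ∏ j : Fin m, if j = i then 1 else g j := by
    intro m i g
    rw [Finset.prod_ite, Finset.prod_const_one, one_mul]
    congr 1
    ext j; simp
  rw [h, h, Fin.prod_univ_succ, if_neg (Fin.succ_ne_zero k).symm]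
  simp only [Fin.succ_inj]

lemma main_induction (τ γ : ℂ) (hτ : 0 < τ.im) (L : ℕ) (μ : Fin L → ℂ) (n : ℕ)
    (lam0 θ : ℂ) (lam : Fin n → ℂ) (hgen : Gen τ γ θ)
    (h0 : ∀ j, thetaf τ (lam j - lam0) ≠ 0)
    (hij : ∀ i j, j ≠ i → thetaf τ (lam j - lam i) ≠ 0) :
    Adyn τ γ μ lam0 (θ + γ) * Ydyn τ γ μ (θ - γ) lam =
      ((thetaf τ (θ + γ) / thetaf τ (θ + ((n : ℂ) + 1) * γ)) *
          ∏ j, thetaf τ (lam j - lam0 + γ) / thetaf τ (lam j - lam0)) •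
        (Ydyn τ γ μ θ lam * Adyn τ γ μ lam0 (θ + ((n : ℂ) + 1) * γ))
      - ∑ i, ((thetaf τ (θ + γ - lam i + lam0) / thetaf τ (θ + ((n : ℂ) + 1) * γ)) *
            (thetaf τ γ / thetaf τ (lam i - lam0)) *
            ∏ j ∈ Finset.univ.erase i,
              thetaf τ (lam j - lam i + γ) / thetaf τ (lam j - lam i)) •
          (Ydyn τ γ μ θ (Fin.cons lam0 lam ∘ Fin.succAbove i.succ) *
            Adyn τ γ μ (lam i) (θ + ((n : ℂ) + 1) * γ)) := by
  induction n generalizing lam0 θ with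
  | zero =>
    have h1 : thetaf τ (θ + γ) ≠ 0 := hgen.ne 1 _ (by push_cast; ring)
    simp [Ydyn, h1]
  | succ n ih =>
    have hgen1 : Gen τ γ (θ + γ) := hgen.shift 1 _ (by push_cast; ring)
    have h2 : thetaf τ (θ + γ + γ) ≠ 0 := hgen.ne 2 _ (by push_cast; ring)
    have hN : θ + γ + ((n : ℂ) + 1) * γ = θ + (((n + 1 : ℕ) : ℂ) + 1) * γ := by push_cast; ring
    have ih0 := ih lam0 (θ + γ) (fun j => lam j.succ) hgen1 (fun j => h0 _)
      (fun i j hne => hij _ _ (fun h => hne (Fin.succ_inj.mp h)))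
    have ih1 := ih (lam 0) (θ + γ) (fun j => lam j.succ) hgen1
      (fun j => hij _ _ (Fin.succ_ne_zero j))
      (fun i j hne => hij _ _ (fun h => hne (Fin.succ_inj.mp h)))
    rw [hN] at ih0 ih1
    have hAB := exchange_AB τ γ hτ μ lam0 (lam 0) θ hgen (h0 0)
    generalize hNN : θ + (((n + 1 : ℕ) : ℂ) + 1) * γ = N at *
    have hlam : lam = Fin.cons (lam 0) (fun j => lam j.succ) := (Fin.cons_self_tail lam).symm
    have y0 : ∀ k : Fin n, Ydyn τ γ μ θ (Fin.cons lam0 lam ∘ Fin.succAbove k.succ.succ) =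
        Bdyn τ γ μ lam0 (θ + γ) * Ydyn τ γ μ (θ + γ)
          (Fin.cons (lam 0) (fun j => lam j.succ) ∘ Fin.succAbove k.succ) := by
      intro k
      have e : (fun i : Fin n => ((Fin.cons lam0 lam : Fin (n + 2) → ℂ) ∘
          Fin.succAbove k.succ.succ) i.succ) = lam ∘ Fin.succAbove k.succ := by
        funext i
        simp
      rw [Ydyn_succ, ← hlam, e]
      rfl
    have y1 : Ydyn τ γ μ θ (Fin.cons lam0 lam ∘ Fin.succAbove (Fin.succ 0)) =
        Bdyn τ γ μ lam0 (θ + γ) * Ydyn τ γ μ (θ + γ) (fun j => lam j.succ) := by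
      rw [Ydyn_succ]
      congr 2
    rw [Ydyn_succ τ γ μ (θ - γ) lam, Ydyn_succ τ γ μ θ lam, sub_add_cancel, ← mul_assoc, hAB,
      sub_mul, smul_mul_assoc, smul_mul_assoc, mul_assoc, mul_assoc]
    rw [add_sub_cancel_right] at ih0 ih1
    rw [ih0, ih1, Fin.sum_univ_succ, Fin.prod_univ_succ, prod_erase_zero, y1]
    simp only [y0, prod_erase_succ]
    have hsum : ∀ (α β δ : Fin n → ℂ) (c1 c2 : ℂ), (∀ k, c1 * α k - c2 * β k = δ k) →
        ∑ k, δ k • (Bdyn τ γ μ lam0 (θ + γ) * Ydyn τ γ μ (θ + γ)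
          (Fin.cons (lam 0) (fun j => lam j.succ) ∘ Fin.succAbove k.succ) *
            Adyn τ γ μ (lam k.succ) N) =
        c1 • (Bdyn τ γ μ (lam 0) (θ + γ) * ∑ k, α k • (Ydyn τ γ μ (θ + γ)
          (Fin.cons lam0 (fun j => lam j.succ) ∘ Fin.succAbove k.succ) *
            Adyn τ γ μ (lam k.succ) N)) -
        c2 • (Bdyn τ γ μ lam0 (θ + γ) * ∑ k, β k • (Ydyn τ γ μ (θ + γ)
          (Fin.cons (lam 0) (fun j => lam j.succ) ∘ Fin.succAbove k.succ) *
            Adyn τ γ μ (lam k.succ) N)) := by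
      intro α β δ c1 c2 hk
      rw [Finset.mul_sum, Finset.mul_sum, Finset.smul_sum, Finset.smul_sum,
        ← Finset.sum_sub_distrib]
      refine Finset.sum_congr rfl (fun k _ => ?_)
      rw [mul_smul_comm, mul_smul_comm, smul_smul, smul_smul, ← mul_assoc, ← mul_assoc,
        swap_Y τ γ hτ μ lam0 (lam 0) (θ + γ) hgen1 (fun j => lam j.succ) k, ← sub_smul, hk]
    rw [hsum _ _ _ _ _ (fun k => coef_identity τ γ hτ (θ + γ) lam0 (lam 0) (lam k.succ)
      (thetaf τ N) (∏ j ∈ Finset.univ.erase k, thetaf τ (lam j.succ - lam k.succ + γ) /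
        thetaf τ (lam j.succ - lam k.succ)) h2 (h0 0) (h0 k.succ)
      (hij _ _ (Fin.succ_ne_zero k)))]
    have canc : ∀ a b c d : ℂ, a / thetaf τ (θ + γ + γ) * b * (thetaf τ (θ + γ + γ) / c * d) =
        a / c * (b * d) := by
      intro a b c d
      field_simp
    rw [mul_sub, mul_sub, smul_sub, smul_sub, mul_smul_comm, mul_smul_comm, smul_smul, smul_smul,
      canc, canc]
    simp only [mul_assoc]
    abel

/-- Degree `n+1` dynamical Yang–Baxter relation.  Here
`Fin.cons lam0 lam ∘ Fin.succAbove i.succ : Fin n → ℂ` is the tuple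
`(λ₀, λ₁, …, λ_{i−1}, λ_{i+1}, …, λ_n)`. -/
theorem dynamical_degree_n1_relation (τ γ : ℂ) (hτ : 0 < τ.im)
    (L : ℕ) (hL : 1 ≤ L) (μ : Fin L → ℂ) (n : ℕ) (hn : 1 ≤ n)
    (lam0 θ : ℂ) (lam : Fin n → ℂ)
    (hgen : ∀ k : ℤ, thetaf τ (θ + γ * k) ≠ 0)
    (h0 : ∀ j, thetaf τ (lam j - lam0) ≠ 0)
    (hij : ∀ i j, j ≠ i → thetaf τ (lam j - lam i) ≠ 0) :
    Adyn τ γ μ lam0 (θ + γ) * Ydyn τ γ μ (θ - γ) lam =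
      ((thetaf τ (θ + γ) / thetaf τ (θ + ((n : ℂ) + 1) * γ)) *
          ∏ j, thetaf τ (lam j - lam0 + γ) / thetaf τ (lam j - lam0)) •
        (Ydyn τ γ μ θ lam * Adyn τ γ μ lam0 (θ + ((n : ℂ) + 1) * γ))
      - ∑ i, ((thetaf τ (θ + γ - lam i + lam0) / thetaf τ (θ + ((n : ℂ) + 1) * γ)) *
            (thetaf τ γ / thetaf τ (lam i - lam0)) *
            ∏ j ∈ Finset.univ.erase i,
              thetaf τ (lam j - lam i + γ) / thetaf τ (lam j - lam i)) •
          (Ydyn τ γ μ θ (Fin.cons lam0 lam ∘ Fin.succAbove i.succ) *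
            Adyn τ γ μ (lam i) (θ + ((n : ℂ) + 1) * γ)) := by
  exact main_induction τ γ hτ L μ n lam0 θ lam hgen h0 hij

end
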